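/- arXiv:0712.2726 — 2 statements merged into one kernel-verified Lean document; each statement's English description precedes it below -/
import Mathlib

section
/- Let p ∈ (2,∞] and let g_i, g_j belong to Mon(M,p,μ). Then: (a) for any q with 1 ≤ q < p, ‖E(g_j(X_n)|X_0) − μ(g_j)‖_q ≤ 2M (p/(p−q))^{1/q} (2α_1(n))^{(p−q)/(pq)}; and (b) for any q with 1 ≤ q < p/2, ‖(g_i(X_0) − μ(g_i))(E(g_j(X_n)|X_0) − μ(g_j))‖_q ≤ 4M^2 (p/(p−2q))^{1/q} (2α_1(n))^{(p−2q)/(pq)}. -/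
open MeasureTheory ProbabilityTheory Filter Set
open scoped ENNReal NNReal Topology

noncomputable section

/-- The intermittent (Liverani–Saussol–Vaienti) map `T_γ` on `[0,1]`. -/
def Tmap (γ : ℝ) (x : ℝ) : ℝ :=
  if x < 1/2 then x * (1 + 2 ^ γ * x ^ γ) else 2 * x - 1

/-- `K` is the Perron–Frobenius operator of `T_γ` with respect to `ν`:
`ν(f · g∘T_γ) = ν(K f · g)` for all bounded measurable `f, g`. -/
def IsPFOp (γ : ℝ) (ν : Measure ℝ) (K : (ℝ → ℝ) → ℝ → ℝ) : Prop :=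
  ∀ f g : ℝ → ℝ, Measurable f → Measurable g → (∃ C, ∀ x, |f x| ≤ C) →
    (∃ C, ∀ x, |g x| ≤ C) →
    ∫ x, f x * g (Tmap γ x) ∂ν = ∫ x, (K f) x * g x ∂ν

/-- Birkhoff sums `S_n(f) = ∑_{i=1}^n f ∘ T_γ^i`. -/
def Sn (γ : ℝ) (f : ℝ → ℝ) (n : ℕ) (x : ℝ) : ℝ :=
  ∑ i ∈ Finset.range n, f ((Tmap γ)^[i + 1] x)

/-- The class `H_{α,1}` of `α`-Hölder functions (with constant 1) on `[0,1]`. -/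
def Hclass (α : ℝ) : Set (ℝ → ℝ) :=
  {f | ∀ x ∈ Set.Icc (0:ℝ) 1, ∀ y ∈ Set.Icc (0:ℝ) 1, |f x - f y| ≤ |x - y| ^ α}

/-- `f_t = 1_{(-∞, t]}`. -/
def indic (t : ℝ) : ℝ → ℝ := Set.indicator (Set.Iic t) (fun _ => 1)

/-- Nested operator `K^{(n_1,…,n_k)}(f_1,…,f_k)
= K^{n_1}(f_1 · K^{n_2}(f_2 ⋯ K^{n_k}(f_k)⋯))`, encoded by a list of pairs. -/
def nestedK (K : (ℝ → ℝ) → ℝ → ℝ) : List (ℕ × (ℝ → ℝ)) → ℝ → ℝ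
  | [] => fun _ => 1
  | (n, f) :: r => K^[n] (fun x => f x * nestedK K r x)

/-- The list `[(n, f_{t_1}), (n_2, f_{t_2}), …, (n_l, f_{t_l})]`. -/
def tList (n : ℕ) {l : ℕ} (ns : Fin l → ℕ) (ts : Fin (l + 1) → ℝ) :
    List (ℕ × (ℝ → ℝ)) :=
  (n, indic (ts 0)) :: List.ofFn (fun i : Fin l => (ns i, indic (ts i.succ)))

/-- The coefficient `α_1(n)` for an operator `K` with invariant measure `ν`. -/
def alpha1 (K : (ℝ → ℝ) → ℝ → ℝ) (ν : Measure ℝ) (n : ℕ) : ℝ :=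
  ⨆ t : ℝ, ∫ x, |K^[n] (indic t) x - ∫ y, indic t y ∂ν| ∂ν

/-- The dependence coefficient `α_k(n)`. -/
def alphaCoef (K : (ℝ → ℝ) → ℝ → ℝ) (ν : Measure ℝ) (k n : ℕ) : ℝ :=
  max (alpha1 K ν n)
    (⨆ j : Fin (k - 1), ⨆ ns : {m : Fin (j.1 + 1) → ℕ // ∀ i, 1 ≤ m i},
      ⨆ ts : Fin (j.1 + 2) → ℝ,
        ∫ x, |nestedK K (tList n ns.1 ts) x - ∫ y, nestedK K (tList n ns.1 ts) y ∂ν| ∂ν)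

/-- The dependence coefficient `β_1(n)`. -/
def beta1 (K : (ℝ → ℝ) → ℝ → ℝ) (ν : Measure ℝ) (n : ℕ) : ℝ :=
  ∫ x, (⨆ t : ℝ, |K^[n] (indic t) x - ∫ y, indic t y ∂ν|) ∂ν

/-- The dependence coefficient `β_k(n)`. -/
def betaCoef (K : (ℝ → ℝ) → ℝ → ℝ) (ν : Measure ℝ) (k n : ℕ) : ℝ :=
  max (beta1 K ν n)
    (⨆ j : Fin (k - 1), ⨆ ns : {m : Fin (j.1 + 1) → ℕ // ∀ i, 1 ≤ m i},
      ∫ x, (⨆ ts : Fin (j.1 + 2) → ℝ,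
        |nestedK K (tList n ns.1 ts) x - ∫ y, nestedK K (tList n ns.1 ts) y ∂ν|) ∂ν)

/-- The operator associated with a Markov transition kernel: `(Kg)(x) = ∫ g(y) K(x,dy)`. -/
def Kop (K : Kernel ℝ ℝ) (g : ℝ → ℝ) : ℝ → ℝ := fun x => ∫ y, g y ∂(K x)

/-- The class `Mon(M,p,μ)` of monotonic functions on an open interval, vanishing
elsewhere, with tail condition `μ(|g|>t) ≤ M^p t^{-p}` (for `p < ∞`),
resp. `μ(|g|>M) = 0` (for `p = ∞`). -/
def Mon (M : ℝ) (p : ℝ≥0∞) (μ : Measure ℝ) (g : ℝ → ℝ) : Prop :=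
  (∃ I : Set ℝ, IsOpen I ∧ I.OrdConnected ∧ (MonotoneOn g I ∨ AntitoneOn g I) ∧
      ∀ x ∉ I, g x = 0) ∧
  (if p = ∞ then μ {x | M < |g x|} = 0
   else ∀ t : ℝ, 0 < t →
      μ {x | t < |g x|} ≤ ENNReal.ofReal (M ^ p.toReal * t ^ (-p.toReal)))

/-- The class `C(M,p,μ)`: the closure in `L¹(μ)` of convex-type combinations
`∑ a_i g_i`, `∑ |a_i| ≤ 1`, `g_i ∈ Mon(M,p,μ)`. -/
def ClassC (M : ℝ) (p : ℝ≥0∞) (μ : Measure ℝ) (f : ℝ → ℝ) : Prop :=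
  Integrable f μ ∧ ∀ ε : ℝ, 0 < ε → ∃ (n : ℕ) (a : Fin n → ℝ) (g : Fin n → ℝ → ℝ),
    (∑ i, |a i|) ≤ 1 ∧ (∀ i, Mon M p μ (g i)) ∧
    ∫ x, |f x - ∑ i, a i * g i x| ∂μ < ε

/-- The class `Lip_c` of functions `g` with `|g(x) − g(y)| ≤ c(|x−y|)`. -/
def LipC (c : ℝ → ℝ) : Set (ℝ → ℝ) := {g | ∀ x y : ℝ, |g x - g y| ≤ c |x - y|}

/-- The distance `d_c(P,Q) = sup_{g ∈ Lip_c} |P(g) − Q(g)|`. -/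
def dC (c : ℝ → ℝ) (P Q : Measure ℝ) : ℝ :=
  ⨆ g : LipC c, |(∫ x, (g : ℝ → ℝ) x ∂P) - ∫ x, (g : ℝ → ℝ) x ∂Q|


/-- The measure on `(0, ∞)` with distribution function `a ↦ a ^ q`. -/
def powMeasure (q : ℝ) : Measure ℝ :=
  (volume.restrict (Ioi 0)).withDensity fun t => ENNReal.ofReal (q * t ^ (q - 1))

instance (q : ℝ) : SFinite (powMeasure q) := by unfold powMeasure; infer_instance

lemma lintegral_powMeasure (q : ℝ) (f : ℝ → ℝ≥0∞) (hf : Measurable f) :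
    ∫⁻ t, f t ∂powMeasure q = ∫⁻ t in Ioi 0, ENNReal.ofReal (q * t ^ (q - 1)) * f t := by
  rw [powMeasure, lintegral_withDensity_eq_lintegral_mul _ (by fun_prop) hf]
  rfl

lemma ae_powMeasure_pos (q : ℝ) : ∀ᵐ t ∂powMeasure q, 0 < t :=
  (withDensity_absolutelyContinuous _ _).ae_le (ae_restrict_mem measurableSet_Ioi)

lemma powMeasure_one : powMeasure 1 = volume.restrict (Ioi 0) := by
  simp [powMeasure]

lemma lintegral_ofReal_rpow {α : Type*} [MeasurableSpace α] (ν : Measure α)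
    {f : α → ℝ} (hf0 : 0 ≤ f) (hf : Measurable f) {q : ℝ} (hq : 0 < q) :
    ∫⁻ x, ENNReal.ofReal (f x ^ q) ∂ν = ∫⁻ t, ν {x | t < f x} ∂powMeasure q := by
  have hm : Measurable fun t : ℝ => ν {x | t < f x} :=
    Antitone.measurable fun s t hst => measure_mono fun x (hx : t < f x) => hst.trans_lt hx
  rw [lintegral_rpow_eq_lintegral_meas_lt_mul ν (ae_of_all _ hf0) hf.aemeasurable hq,
    lintegral_powMeasure q _ hm, ← lintegral_const_mul' _ _ ENNReal.ofReal_ne_top]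
  refine lintegral_congr fun t => ?_
  rw [ENNReal.ofReal_mul hq.le]
  ring

lemma powMeasure_Iio {q a : ℝ} (hq : 0 < q) (ha : 0 ≤ a) :
    powMeasure q (Iio a) = ENNReal.ofReal (a ^ q) := by
  have h := lintegral_ofReal_rpow (Measure.dirac ()) (f := fun _ => a) (fun _ => ha)
    measurable_const hq
  rw [lintegral_dirac] at h
  rw [h, ← lintegral_indicator_one measurableSet_Iio]
  refine lintegral_congr fun t => ?_
  by_cases ht : t < a <;> simp [ht]

lemma powMeasure_Iic {q a : ℝ} (hq : 0 < q) (ha : 0 ≤ a) :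
    powMeasure q (Iic a) = ENNReal.ofReal (a ^ q) := by
  rw [← powMeasure_Iio hq ha]
  refine measure_congr (Iio_ae_eq_Iic' ?_).symm
  exact (withDensity_absolutelyContinuous _ _) (by simp)

/-- A bathtub inequality: among densities bounded by `1` with given total mass, the indicator of
an initial segment minimizes the integral against an increasing weight. -/
lemma rpow_lintegral_le_lintegral_powMeasure {v : ℝ → ℝ≥0∞} (hv : Measurable v)
    (hv1 : ∀ t, v t ≤ 1) {q : ℝ} (hq : 1 ≤ q) :
    (∫⁻ t in Ioi 0, v t) ^ q ≤ ∫⁻ t, v t ∂powMeasure q := by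
  have hq0 : 0 < q := by linarith
  suffices H : ∀ a : ℝ≥0, (a : ℝ≥0∞) < ∫⁻ t in Ioi 0, v t →
      (a : ℝ≥0∞) ^ q ≤ ∫⁻ t, v t ∂powMeasure q by
    rw [← ENNReal.le_rpow_inv_iff hq0]
    refine ENNReal.le_of_forall_nnreal_lt fun a ha => ?_
    rw [ENNReal.le_rpow_inv_iff hq0]
    exact H a ha
  intro a ha
  set w : ℝ → ℝ≥0∞ := fun t => ENNReal.ofReal (q * t ^ (q - 1)) with hw
  have hwm : Measurable w := by fun_prop
  have hw_mono : ∀ s t, 0 < s → s ≤ t → w s ≤ w t := fun s t hs hst =>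
    ENNReal.ofReal_le_ofReal
      (mul_le_mul_of_nonneg_left (Real.rpow_le_rpow hs.le hst (by linarith)) hq0.le)
  have ha0 : (0 : ℝ) ≤ a := a.2
  have hunion : Ioi (0 : ℝ) = Ioc 0 (a : ℝ) ∪ Ioi (a : ℝ) := (Ioc_union_Ioi_eq_Ioi ha0).symm
  have hdisj : Disjoint (Ioc 0 (a : ℝ)) (Ioi (a : ℝ)) :=
    Set.disjoint_left.2 fun x hx hx' => not_lt.2 hx.2 hx'
  have split : ∀ f : ℝ → ℝ≥0∞,
      ∫⁻ t in Ioi 0, f t = (∫⁻ t in Ioc 0 (a : ℝ), f t) + ∫⁻ t in Ioi (a : ℝ), f t := fun f => by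
    rw [hunion, lintegral_union measurableSet_Ioi hdisj]
  have hvol : (∫⁻ t in Ioc 0 (a : ℝ), v t) + ∫⁻ t in Ioc 0 (a : ℝ), (1 - v t) = a := by
    rw [← lintegral_add_left hv]
    simp [add_tsub_cancel_of_le (hv1 _)]
  have hfin : ∫⁻ t in Ioc 0 (a : ℝ), v t ≠ ∞ := fun h => by simp [h] at hvol
  have hcomp : ∫⁻ t in Ioc 0 (a : ℝ), (1 - v t) ≤ ∫⁻ t in Ioi (a : ℝ), v t := by
    refine (ENNReal.add_le_add_iff_left hfin).1 ?_
    rw [hvol, ← split]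
    exact ha.le
  have hpow : (a : ℝ≥0∞) ^ q = ∫⁻ t in Ioc 0 (a : ℝ), w t := by
    have h1 := powMeasure_Iic hq0 ha0
    rw [powMeasure, withDensity_apply _ measurableSet_Iic, Measure.restrict_restrict
      measurableSet_Iic, inter_comm, Ioi_inter_Iic] at h1
    rw [h1, ← ENNReal.ofReal_rpow_of_nonneg ha0 hq0.le, ENNReal.ofReal_coe_nnreal]
  calc (a : ℝ≥0∞) ^ q = ∫⁻ t in Ioc 0 (a : ℝ), (w t * v t + w t * (1 - v t)) := by
        rw [hpow]
        refine lintegral_congr fun t => ?_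
        rw [← mul_add, add_tsub_cancel_of_le (hv1 t), mul_one]
    _ = (∫⁻ t in Ioc 0 (a : ℝ), w t * v t) + ∫⁻ t in Ioc 0 (a : ℝ), w t * (1 - v t) :=
        lintegral_add_left (by fun_prop) _
    _ ≤ (∫⁻ t in Ioc 0 (a : ℝ), w t * v t) + w a * ∫⁻ t in Ioc 0 (a : ℝ), (1 - v t) := by
        gcongr
        rw [← lintegral_const_mul _ (by fun_prop : Measurable fun t => 1 - v t)]
        exact setLIntegral_mono (by fun_prop) fun t ht =>
          mul_le_mul_left (hw_mono t a ht.1 ht.2) _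
    _ ≤ (∫⁻ t in Ioc 0 (a : ℝ), w t * v t) + w a * ∫⁻ t in Ioi (a : ℝ), v t := by gcongr
    _ ≤ (∫⁻ t in Ioc 0 (a : ℝ), w t * v t) + ∫⁻ t in Ioi (a : ℝ), w t * v t := by
        rcases eq_or_lt_of_le ha0 with h | h
        · rw [← lintegral_const_mul _ hv]
          refine add_le_add_right ?_ _
          refine setLIntegral_mono (by fun_prop) fun t ht => ?_
          rw [← h] at ht ⊢
          rcases eq_or_lt_of_le hq with hq1 | hq1
          · simp [hw, ← hq1]
          · simp [hw, Real.zero_rpow (by linarith : q - 1 ≠ 0)]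
        · rw [← lintegral_const_mul _ hv]
          refine add_le_add_right ?_ _
          exact setLIntegral_mono (by fun_prop) fun t ht =>
            mul_le_mul_left (hw_mono a t h (mem_Ioi.1 ht).le) _
    _ = ∫⁻ t, v t ∂powMeasure q := by rw [lintegral_powMeasure q v hv, split]

/-- Two-dimensional layer cake: integrating a function of `max s t` reduces to one dimension. -/
lemma lintegral_lintegral_powMeasure_le {ψ : ℝ → ℝ≥0∞} (hψ : Measurable ψ) {c : ℝ → ℝ → ℝ≥0∞}
    {q : ℝ} (hq : 0 < q) (hcs : ∀ s t, 0 < s → 0 < t → c s t ≤ ψ s)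
    (hct : ∀ s t, 0 < s → 0 < t → c s t ≤ ψ t) :
    ∫⁻ s, ∫⁻ t, c s t ∂powMeasure q ∂powMeasure q ≤ ∫⁻ t, ψ t ∂powMeasure (2 * q) := by
  have hA : MeasurableSet {z : ℝ × ℝ | z.2 ≤ z.1} := measurableSet_le measurable_snd measurable_fst
  have hB : MeasurableSet {z : ℝ × ℝ | z.1 < z.2} := measurableSet_lt measurable_fst measurable_snd
  have hf : Measurable (Function.uncurry fun s t : ℝ => (Iic s).indicator (fun _ => ψ s) t) :=
    (hψ.comp measurable_fst).indicator hA
  have hg : Measurable (Function.uncurry fun s t : ℝ => (Iio t).indicator (fun _ => ψ t) s) :=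
    (hψ.comp measurable_snd).indicator hB
  have key : ∀ᵐ s ∂powMeasure q, ψ s * powMeasure q (Iic s) + ψ s * powMeasure q (Iio s)
      = ENNReal.ofReal (2 * s ^ q) * ψ s := by
    filter_upwards [ae_powMeasure_pos q] with s hs
    have : 0 ≤ s ^ q := by positivity
    rw [powMeasure_Iic hq hs.le, powMeasure_Iio hq hs.le, ENNReal.ofReal_mul (by norm_num)]
    simp only [ENNReal.ofReal_ofNat]
    ring
  calc ∫⁻ s, ∫⁻ t, c s t ∂powMeasure q ∂powMeasure q
      ≤ ∫⁻ s, ∫⁻ t, ((Iic s).indicator (fun _ => ψ s) t + (Iio t).indicator (fun _ => ψ t) s)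
          ∂powMeasure q ∂powMeasure q := by
        refine lintegral_mono_ae ((ae_powMeasure_pos q).mono fun s hs => ?_)
        refine lintegral_mono_ae ((ae_powMeasure_pos q).mono fun t ht => ?_)
        rcases le_or_gt t s with h | h
        · simpa [h, not_lt.2 h] using hcs s t hs ht
        · simpa [h, not_le.2 h] using hct s t hs ht
    _ = (∫⁻ s, ∫⁻ t, (Iic s).indicator (fun _ => ψ s) t ∂powMeasure q ∂powMeasure q) +
        ∫⁻ s, ∫⁻ t, (Iio t).indicator (fun _ => ψ t) s ∂powMeasure q ∂powMeasure q := by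
        refine Eq.trans (lintegral_congr fun s => ?_)
          (lintegral_add_left hf.lintegral_prod_right' _)
        exact lintegral_add_left (hf.comp measurable_prodMk_left) _
    _ = ∫⁻ s, (ψ s * powMeasure q (Iic s) + ψ s * powMeasure q (Iio s)) ∂powMeasure q := by
        rw [lintegral_lintegral_swap hg.aemeasurable, ← lintegral_add_left]
        · simp only [lintegral_indicator_const measurableSet_Iic,
            lintegral_indicator_const measurableSet_Iio]
        · exact hf.lintegral_prod_right'
    _ = ∫⁻ s, ENNReal.ofReal (2 * s ^ q) * ψ s ∂powMeasure q := lintegral_congr_ae key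
    _ = ∫⁻ t, ψ t ∂powMeasure (2 * q) := by
        rw [lintegral_powMeasure _ _ (by fun_prop), lintegral_powMeasure _ _ hψ]
        refine setLIntegral_congr_fun measurableSet_Ioi fun s hs => ?_
        have hs : 0 < s := hs
        rw [← mul_assoc, ← ENNReal.ofReal_mul (by positivity)]
        congr 2
        rw [show 2 * q - 1 = (q - 1) + q by ring, Real.rpow_add hs]
        ring

/-- The tail bound defining `Mon M p μ`. -/
def tailBound (M : ℝ) (p : ℝ≥0∞) (t : ℝ) : ℝ≥0∞ :=
  if p = ∞ then (Iio M).indicator 1 t else ENNReal.ofReal (M ^ p.toReal * t ^ (-p.toReal))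

lemma measurable_tailBound (M : ℝ) (p : ℝ≥0∞) : Measurable (tailBound M p) := by
  unfold tailBound
  split_ifs
  · exact measurable_one.indicator measurableSet_Iio
  · fun_prop

lemma lintegral_min_tailBound_le {M : ℝ} (hM : 0 < M) {p : ℝ≥0∞} (hp0 : p ≠ 0) {a : ℝ}
    (ha : 0 ≤ a) {k : ℝ} (hk : 0 < k) (hkp : k * p⁻¹.toReal < 1) :
    ∫⁻ t, min (ENNReal.ofReal a) (tailBound M p t) ∂powMeasure k ≤
      ENNReal.ofReal (M ^ k * (1 - k * p⁻¹.toReal)⁻¹ * a ^ (1 - k * p⁻¹.toReal)) := by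
  rcases ha.eq_or_lt with rfl | ha
  · simp
  by_cases hp : p = ∞
  · subst hp
    calc ∫⁻ t, min (ENNReal.ofReal a) (tailBound M ∞ t) ∂powMeasure k
        ≤ ∫⁻ t, (Iio M).indicator (fun _ => ENNReal.ofReal a) t ∂powMeasure k := by
          refine lintegral_mono fun t => ?_
          by_cases ht : t < M <;> simp [tailBound, ht]
      _ ≤ _ := by
          rw [lintegral_indicator_const measurableSet_Iio, powMeasure_Iio hk hM.le,
            ← ENNReal.ofReal_mul ha.le]
          simp [mul_comm]
  · set P := p.toReal with hP
    have hP0 : 0 < P := ENNReal.toReal_pos hp0 hp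
    rw [ENNReal.toReal_inv, ← hP] at hkp ⊢
    have hkP : k < P := by
      rwa [← div_eq_mul_inv, div_lt_one hP0] at hkp
    have hPk : 0 < P - k := by linarith
    set T := M * a ^ (-P⁻¹) with hT
    have hT0 : 0 < T := by positivity
    have hTP : T ^ P = M ^ P * a⁻¹ := by
      rw [hT, Real.mul_rpow hM.le (by positivity), ← Real.rpow_mul ha.le, neg_mul,
        inv_mul_cancel₀ hP0.ne', Real.rpow_neg_one]
    have hTk : T ^ k = M ^ k * a ^ (-(k * P⁻¹)) := by
      rw [hT, Real.mul_rpow hM.le (by positivity), ← Real.rpow_mul ha.le]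
      ring_nf
    have h1 : ∫⁻ t in Iic T, min (ENNReal.ofReal a) (tailBound M p t) ∂powMeasure k ≤
        ENNReal.ofReal (a * T ^ k) := by
      calc _ ≤ ∫⁻ t in Iic T, ENNReal.ofReal a ∂powMeasure k :=
            lintegral_mono fun t => min_le_left _ _
        _ = _ := by
            rw [setLIntegral_const, powMeasure_Iic hk hT0.le, ← ENNReal.ofReal_mul ha.le]
    have h2 : ∫⁻ t in Ioi T, min (ENNReal.ofReal a) (tailBound M p t) ∂powMeasure k ≤
        ENNReal.ofReal (k * M ^ P * (T ^ (k - P) / (P - k))) := by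
      calc _ ≤ ∫⁻ t in Ioi T, ENNReal.ofReal (M ^ P * t ^ (-P)) ∂powMeasure k :=
            lintegral_mono fun t => (min_le_right _ _).trans (by simp [tailBound, hp, ← hP])
        _ = ∫⁻ t in Ioi T, ENNReal.ofReal (k * M ^ P * t ^ (k - P - 1)) := by
            rw [← lintegral_indicator measurableSet_Ioi, lintegral_powMeasure _ _
              (Measurable.indicator (by fun_prop) measurableSet_Ioi)]
            have hind : ∀ t, ENNReal.ofReal (k * t ^ (k - 1)) *
                (Ioi T).indicator (fun t => ENNReal.ofReal (M ^ P * t ^ (-P))) t =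
                (Ioi T).indicator (fun t => ENNReal.ofReal (k * t ^ (k - 1)) *
                  ENNReal.ofReal (M ^ P * t ^ (-P))) t :=
              fun t => by by_cases ht : t ∈ Ioi T <;> simp [ht]
            simp_rw [hind]
            rw [lintegral_indicator measurableSet_Ioi, Measure.restrict_restrict measurableSet_Ioi,
              Ioi_inter_Ioi, sup_eq_left.2 hT0.le]
            refine setLIntegral_congr_fun measurableSet_Ioi fun t ht => ?_
            have ht : 0 < t := hT0.trans ht
            rw [← ENNReal.ofReal_mul (by positivity),
              show k - P - 1 = (k - 1) + (-P) by ring, Real.rpow_add ht]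
            ring_nf
        _ = ENNReal.ofReal (∫ t in Ioi T, k * M ^ P * t ^ (k - P - 1)) := by
            rw [ofReal_integral_eq_lintegral_ofReal]
            · exact (integrableOn_Ioi_rpow_of_lt (by linarith) hT0).const_mul _
            · filter_upwards [ae_restrict_mem measurableSet_Ioi] with t ht
              have ht : 0 < t := hT0.trans ht
              exact mul_nonneg (by positivity) (by positivity)
        _ = _ := by
            rw [integral_const_mul, integral_Ioi_rpow_of_lt (by linarith) hT0]
            rw [show k - P - 1 + 1 = k - P by ring, ← neg_sub P k, neg_div_neg_eq]
    rw [← lintegral_add_compl _ measurableSet_Iic, compl_Iic]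
    refine (add_le_add h1 h2).trans ?_
    rw [← ENNReal.ofReal_add (by positivity) (by positivity)]
    refine ENNReal.ofReal_le_ofReal (le_of_eq ?_)
    rw [Real.rpow_sub hT0, hTP, hTk, sub_eq_add_neg (1 : ℝ), Real.rpow_add ha, Real.rpow_one]
    have : 1 + -(k * P⁻¹) = (P - k) / P := by field_simp; ring
    rw [this]
    have hMP : M ^ P ≠ 0 := by positivity
    field_simp
    ring

lemma Kernel.measurable_real {κ : Kernel ℝ ℝ} {A : Set ℝ} (hA : MeasurableSet A) :
    Measurable fun x => (κ x).real A :=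
  (κ.measurable_coe hA).ennreal_toReal

/-- The `L¹` deviation of half-lines controls that of lower sets. -/
lemma lintegral_deviation_lowerSet_le {μ : Measure ℝ} [IsProbabilityMeasure μ]
    {κ : Kernel ℝ ℝ} [IsMarkovKernel κ] {a : ℝ≥0∞}
    (ha : ∀ t, ∫⁻ x, ‖(κ x).real (Iic t) - μ.real (Iic t)‖ₑ ∂μ ≤ a)
    {L : Set ℝ} (hL : IsLowerSet L) :
    ∫⁻ x, ‖(κ x).real L - μ.real L‖ₑ ∂μ ≤ a := by
  rcases L.eq_empty_or_nonempty with rfl | hne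
  · simp
  by_cases hb : BddAbove L
  swap
  · have : L = univ := eq_univ_of_forall fun x => by
      obtain ⟨y, hy, hxy⟩ := not_bddAbove_iff.1 hb x
      exact hL hxy.le hy
    simp [this]
  by_cases hs : sSup L ∈ L
  · have : L = Iic (sSup L) := Subset.antisymm (fun x hx => le_csSup hb hx)
      fun x hx => hL hx hs
    rw [this]
    exact ha _
  have hIio : L = Iio (sSup L) := by
    refine Subset.antisymm (fun x hx => lt_of_le_of_ne (le_csSup hb hx) ?_) fun x hx => ?_
    · rintro rfl
      exact hs hx
    · obtain ⟨y, hy, hxy⟩ := exists_lt_of_lt_csSup hne hx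
      exact hL hxy.le hy
  obtain ⟨u, hu, hus, hut⟩ := exists_seq_strictMono_tendsto (sSup L)
  have hU : ⋃ n, Iic (u n) = L := by
    rw [hIio]
    exact iUnion_Iic_eq_Iio_of_lt_of_tendsto hus hut
  have hlim : ∀ ν : Measure ℝ, IsProbabilityMeasure ν →
      Tendsto (fun n => ν.real (Iic (u n))) atTop (𝓝 (ν.real L)) := fun ν _ => by
    have := tendsto_measure_iUnion_atTop (μ := ν) (s := fun n => Iic (u n))
      fun m n h => Iic_subset_Iic.2 (hu.monotone h)
    rw [hU] at this
    exact (ENNReal.tendsto_toReal (measure_ne_top _ _)).comp this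
  calc ∫⁻ x, ‖(κ x).real L - μ.real L‖ₑ ∂μ
      = ∫⁻ x, liminf (fun n => ‖(κ x).real (Iic (u n)) - μ.real (Iic (u n))‖ₑ) atTop ∂μ :=
        lintegral_congr fun x =>
          (((hlim (κ x) inferInstance).sub (hlim μ inferInstance)).enorm.liminf_eq).symm
    _ ≤ liminf (fun n => ∫⁻ x, ‖(κ x).real (Iic (u n)) - μ.real (Iic (u n))‖ₑ ∂μ) atTop :=
        lintegral_liminf_le fun n =>
          ((Kernel.measurable_real measurableSet_Iic).sub_const _).enorm
    _ ≤ a := liminf_le_of_le (by isBoundedDefault) fun b hb => by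
        obtain ⟨n, hn⟩ := hb.exists
        exact hn.trans (ha _)

lemma lintegral_deviation_ordConnected_le {μ : Measure ℝ} [IsProbabilityMeasure μ]
    {κ : Kernel ℝ ℝ} [IsMarkovKernel κ] {a : ℝ≥0∞}
    (ha : ∀ t, ∫⁻ x, ‖(κ x).real (Iic t) - μ.real (Iic t)‖ₑ ∂μ ≤ a)
    {A : Set ℝ} (hA : A.OrdConnected) :
    ∫⁻ x, ‖(κ x).real A - μ.real A‖ₑ ∂μ ≤ 2 * a := by
  rcases A.eq_empty_or_nonempty with rfl | ⟨y, hy⟩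
  · simp
  set B : Set ℝ := {x | ∃ b ∈ A, x ≤ b} with hB
  set C : Set ℝ := {x | ∀ b ∈ A, x < b} with hC
  have hBl : IsLowerSet B := fun x z hzx ⟨b, hb, hxb⟩ => ⟨b, hb, hzx.trans hxb⟩
  have hCl : IsLowerSet C := fun x z hzx hx b hb => hzx.trans_lt (hx b hb)
  have hCB : C ⊆ B := fun x hx => ⟨y, hy, (hx y hy).le⟩
  have hAe : A = B \ C := by
    refine Subset.antisymm (fun x hx => ⟨⟨x, hx, le_rfl⟩, fun h => lt_irrefl x (h x hx)⟩) ?_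
    rintro x ⟨⟨b, hb, hxb⟩, hx⟩
    simp only [hC, mem_ofPred_eq, not_forall, not_lt] at hx
    obtain ⟨c, hc, hcx⟩ := hx
    exact hA.out hc hb ⟨hcx, hxb⟩
  have hBm : MeasurableSet B := hBl.ordConnected.measurableSet
  have hCm : MeasurableSet C := hCl.ordConnected.measurableSet
  calc ∫⁻ x, ‖(κ x).real A - μ.real A‖ₑ ∂μ
      ≤ ∫⁻ x, (‖(κ x).real B - μ.real B‖ₑ + ‖(κ x).real C - μ.real C‖ₑ) ∂μ := by
        refine lintegral_mono fun x => ?_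
        rw [hAe, measureReal_sdiff hCB hCm, measureReal_sdiff hCB hCm, sub_sub_sub_comm]
        exact enorm_sub_le
    _ = _ := lintegral_add_left ((Kernel.measurable_real hBm).sub_const _).enorm _
    _ ≤ a + a := add_le_add (lintegral_deviation_lowerSet_le ha hBl)
        (lintegral_deviation_lowerSet_le ha hCl)
    _ = 2 * a := (two_mul a).symm

lemma enorm_integral_sub_le_lintegral_deviation {ν μ : Measure ℝ} [IsProbabilityMeasure ν]
    [IsProbabilityMeasure μ] {f : ℝ → ℝ} (hf0 : 0 ≤ f) (hν : Integrable f ν)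
    (hμ : Integrable f μ) :
    ‖∫ x, f x ∂ν - ∫ x, f x ∂μ‖ₑ ≤
      ∫⁻ t in Ioi 0, ‖ν.real {x | t < f x} - μ.real {x | t < f x}‖ₑ := by
  have hint : ∀ ρ : Measure ℝ, IsProbabilityMeasure ρ → Integrable f ρ →
      IntegrableOn (fun t => ρ.real {x | t < f x}) (Ioi 0) := fun ρ _ hρ => by
    have hm : Measurable fun t : ℝ => ρ {x | t < f x} :=
      Antitone.measurable fun s t hst => measure_mono fun x (hx : t < f x) => hst.trans_lt hx
    refine integrable_toReal_of_lintegral_ne_top hm.aemeasurable ?_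
    rw [← lintegral_eq_lintegral_meas_lt ρ (ae_of_all _ hf0) hρ.aemeasurable]
    exact hρ.lintegral_lt_top.ne
  rw [hν.integral_eq_integral_meas_lt (ae_of_all _ hf0),
    hμ.integral_eq_integral_meas_lt (ae_of_all _ hf0), ← integral_sub (hint ν ‹_› hν)
      (hint μ ‹_› hμ)]
  exact enorm_integral_le_lintegral_enorm _

lemma exists_kernel_iterate {μ : Measure ℝ} (K : Kernel ℝ ℝ)
    [IsMarkovKernel K] (hinv : K ∘ₘ μ = μ) (n : ℕ) :
    ∃ κ : Kernel ℝ ℝ, IsMarkovKernel κ ∧ κ ∘ₘ μ = μ ∧ ∀ g : ℝ → ℝ, Integrable g μ →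
      (Kop K)^[n] g =ᵐ[μ] fun x => ∫ y, g y ∂κ x := by
  induction n with
  | zero =>
    refine ⟨Kernel.id, inferInstance, Measure.id_comp, fun g _ => ae_of_all _ fun x => ?_⟩
    simp [Kernel.id_apply]
  | succ n ih =>
    obtain ⟨κ, hκ, hκμ, h⟩ := ih
    refine ⟨κ ∘ₖ K, inferInstance, by rw [← Measure.comp_assoc, hinv, hκμ], fun g hg => ?_⟩
    have h1 : ∀ᵐ x ∂μ, ∀ᵐ y ∂K x, (Kop K)^[n] g y = ∫ z, g z ∂κ y :=
      Measure.ae_ae_of_ae_comp (by rw [hinv]; exact h g hg)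
    have h2 : ∀ᵐ x ∂μ, Integrable g ((κ ∘ₖ K) x) :=
      Measure.ae_integrable_of_integrable_comp
        (by rwa [← Measure.comp_assoc, hinv, hκμ])
    filter_upwards [h1, h2] with x hx1 hx2
    rw [Function.iterate_succ_apply', Kop, integral_congr_ae hx1, Kernel.integral_comp hx2]

lemma Mon.neg {M : ℝ} {p : ℝ≥0∞} {μ : Measure ℝ} {g : ℝ → ℝ} (hg : Mon M p μ g) :
    Mon M p μ (-g) := by
  obtain ⟨⟨I, hIo, hI, hmono, h0⟩, htail⟩ := hg
  refine ⟨⟨I, hIo, hI, ?_, fun x hx => by simp [h0 x hx]⟩, by simpa using htail⟩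
  exact hmono.symm.imp (fun h => h.neg) fun h => h.neg

lemma Mon.ordConnected_lt {M : ℝ} {p : ℝ≥0∞} {μ : Measure ℝ} {g : ℝ → ℝ} (hg : Mon M p μ g)
    {t : ℝ} (ht : 0 ≤ t) : {x | t < g x}.OrdConnected := by
  obtain ⟨⟨I, -, hI, hmono, h0⟩, -⟩ := hg
  have hmem : ∀ x, t < g x → x ∈ I := fun x hx => by
    by_contra h
    rw [h0 x h] at hx
    exact not_lt.2 ht hx
  refine ⟨fun x (hx : t < g x) y (hy : t < g y) z hz => ?_⟩
  have hzI := hI.out (hmem x hx) (hmem y hy) hz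
  rcases hmono with h | h
  · exact hx.trans_le (h (hmem x hx) hzI hz.1)
  · exact hy.trans_le (h hzI (hmem y hy) hz.2)

lemma Mon.measurable {M : ℝ} {p : ℝ≥0∞} {μ : Measure ℝ} {g : ℝ → ℝ} (hg : Mon M p μ g) :
    Measurable g := by
  have key : ∀ f : ℝ → ℝ, Mon M p μ f → Measurable fun x => max (f x) 0 := fun f hf => by
    refine measurable_of_Ioi fun t => ?_
    rcases lt_or_ge t 0 with ht | ht
    · convert MeasurableSet.univ
      ext x
      simp [ht]
    · convert (hf.ordConnected_lt ht).measurableSet using 1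
      ext x
      simp [not_lt.2 ht]
  convert! (key g hg).sub (key _ hg.neg) using 1
  ext x
  rcases le_total (g x) 0 with h | h <;> simp [h]

lemma Mon.measure_lt_abs_le {M : ℝ} {p : ℝ≥0∞} {μ : Measure ℝ} [IsProbabilityMeasure μ]
    {g : ℝ → ℝ} (hg : Mon M p μ g) {t : ℝ} (ht : 0 < t) :
    μ {x | t < |g x|} ≤ tailBound M p t := by
  obtain ⟨-, htail⟩ := hg
  unfold tailBound
  split_ifs at htail ⊢
  · by_cases h : t < M
    · simpa [h] using prob_le_one
    · refine (measure_mono fun x (hx : t < |g x|) => ?_).trans (htail.le.trans zero_le)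
      exact (not_lt.1 h).trans_lt hx
  · exact htail t ht

lemma lintegral_enorm_eq_lintegral_measure_lt_abs {μ : Measure ℝ} {g : ℝ → ℝ}
    (hg : Measurable g) : ∫⁻ x, ‖g x‖ₑ ∂μ = ∫⁻ t in Ioi 0, μ {x | t < |g x|} := by
  simp_rw [Real.enorm_eq_ofReal_abs]
  exact lintegral_eq_lintegral_meas_lt μ (ae_of_all _ fun x => abs_nonneg _)
    hg.abs.aemeasurable

lemma Mon.integrable {M : ℝ} (hM : 0 < M) {p : ℝ≥0∞} (hp : 1 < p) {μ : Measure ℝ}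
    [IsProbabilityMeasure μ] {g : ℝ → ℝ} (hg : Mon M p μ g) : Integrable g μ := by
  refine ⟨hg.measurable.aestronglyMeasurable, ?_⟩
  have hp1 : 1 * p⁻¹.toReal < 1 := by
    rw [one_mul, ← ENNReal.toReal_one]
    exact ENNReal.toReal_strict_mono ENNReal.one_ne_top (ENNReal.inv_lt_one.2 hp)
  rw [HasFiniteIntegral, lintegral_enorm_eq_lintegral_measure_lt_abs hg.measurable]
  refine lt_of_le_of_lt ?_ ((lintegral_min_tailBound_le hM (zero_lt_one.trans hp).ne'
    zero_le_one one_pos hp1).trans_lt ENNReal.ofReal_lt_top)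
  rw [powMeasure_one]
  exact setLIntegral_mono (measurable_const.min (measurable_tailBound M p)) fun t ht =>
    le_min (by simpa using prob_le_one) (hg.measure_lt_abs_le ht)

/-- Half the total deviation of the upper and lower level sets of `g` at height `t`. -/
def levelDeviation (κ : Kernel ℝ ℝ) (μ : Measure ℝ) (g : ℝ → ℝ) (t x : ℝ) : ℝ≥0∞ :=
  2⁻¹ * (‖(κ x).real {y | t < g y} - μ.real {y | t < g y}‖ₑ +
    ‖(κ x).real {y | t < -g y} - μ.real {y | t < -g y}‖ₑ)

section LevelDeviation

variable {κ : Kernel ℝ ℝ} {μ : Measure ℝ} [IsMarkovKernel κ] [IsProbabilityMeasure μ] {g : ℝ → ℝ}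

lemma levelDeviation_le_one (t x : ℝ) : levelDeviation κ μ g t x ≤ 1 := by
  have h : ∀ A : Set ℝ, ‖(κ x).real A - μ.real A‖ₑ ≤ 1 := fun A => by
    rw [Real.enorm_eq_ofReal_abs, ENNReal.ofReal_le_one, abs_le]
    have h1 : (κ x).real A ≤ 1 := measureReal_le_one
    have h2 : μ.real A ≤ 1 := measureReal_le_one
    have h3 : 0 ≤ (κ x).real A := measureReal_nonneg
    have h4 : 0 ≤ μ.real A := measureReal_nonneg
    constructor <;> linarith
  calc levelDeviation κ μ g t x ≤ 2⁻¹ * (1 + 1) := by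
        unfold levelDeviation
        gcongr <;> exact h _
    _ = 1 := by rw [one_add_one_eq_two, ENNReal.inv_mul_cancel (by simp) (by simp)]

lemma measurable_levelDeviation (hg : Measurable g) :
    Measurable (Function.uncurry (levelDeviation κ μ g)) := by
  have h : ∀ f : ℝ → ℝ, Measurable f →
      Measurable fun z : ℝ × ℝ => ‖(κ z.2).real {y | z.1 < f y} - μ.real {y | z.1 < f y}‖ₑ :=
    fun f hf => by
      have hs : MeasurableSet {w : (ℝ × ℝ) × ℝ | w.1.1 < f w.2} :=
        measurableSet_lt (by fun_prop) (by fun_prop)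
      have h1 := Kernel.measurable_kernel_prodMk_left
        (κ := κ.comap (Prod.snd : ℝ × ℝ → ℝ) measurable_snd) hs
      have h2 := Kernel.measurable_kernel_prodMk_left (κ := Kernel.const (ℝ × ℝ) μ) hs
      exact (h1.ennreal_toReal.sub h2.ennreal_toReal).enorm
  exact ((h g hg).add (h (fun x => -g x) hg.neg)).const_mul _

lemma lintegral_levelDeviation_le_measure (hκ : κ ∘ₘ μ = μ) (hg : Measurable g) {t : ℝ}
    (ht : 0 ≤ t) : ∫⁻ x, levelDeviation κ μ g t x ∂μ ≤ μ {x | t < |g x|} := by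
  have h : ∀ A : Set ℝ, MeasurableSet A →
      ∫⁻ x, ‖(κ x).real A - μ.real A‖ₑ ∂μ ≤ 2 * μ A := fun A hA => by
    calc ∫⁻ x, ‖(κ x).real A - μ.real A‖ₑ ∂μ ≤ ∫⁻ x, (κ x A + μ A) ∂μ := by
          refine lintegral_mono fun x => enorm_sub_le.trans (le_of_eq ?_)
          rw [Real.enorm_of_nonneg measureReal_nonneg, Real.enorm_of_nonneg measureReal_nonneg,
            ofReal_measureReal, ofReal_measureReal]
      _ = 2 * μ A := by
          rw [lintegral_add_left (κ.measurable_coe hA), ← Measure.bind_apply hA κ.aemeasurable,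
            hκ, lintegral_const, measure_univ, mul_one, two_mul]
  have hA : MeasurableSet {x | t < g x} := measurableSet_lt measurable_const hg
  have hB : MeasurableSet {x | t < -g x} := measurableSet_lt measurable_const hg.neg
  have hdisj : Disjoint {x | t < g x} {x | t < -g x} :=
    Set.disjoint_left.2 fun x (h1 : t < g x) (h2 : t < -g x) => by linarith
  have hunion : {x | t < |g x|} = {x | t < g x} ∪ {x | t < -g x} := by
    ext x
    exact lt_abs (a := t) (b := g x)
  unfold levelDeviation
  rw [lintegral_const_mul' _ _ (by simp), lintegral_add_left
    ((Kernel.measurable_real hA).sub_const _).enorm, hunion, measure_union hdisj hB]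
  calc _ ≤ 2⁻¹ * (2 * μ {x | t < g x} + 2 * μ {x | t < -g x}) := by
        gcongr
        · exact h _ hA
        · exact h _ hB
    _ = _ := by
        rw [← mul_add, ← mul_assoc, ENNReal.inv_mul_cancel (by simp) (by simp), one_mul]

lemma lintegral_levelDeviation_le_coef {M : ℝ} {p : ℝ≥0∞} (hg : Mon M p μ g) {a : ℝ≥0∞}
    (ha : ∀ t, ∫⁻ x, ‖(κ x).real (Iic t) - μ.real (Iic t)‖ₑ ∂μ ≤ a) {t : ℝ} (ht : 0 ≤ t) :
    ∫⁻ x, levelDeviation κ μ g t x ∂μ ≤ 2 * a := by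
  have hA := hg.ordConnected_lt ht
  have hB := hg.neg.ordConnected_lt ht
  unfold levelDeviation
  rw [lintegral_const_mul' _ _ (by simp), lintegral_add_left
    ((Kernel.measurable_real hA.measurableSet).sub_const _).enorm]
  calc _ ≤ 2⁻¹ * (2 * a + 2 * a) := by
        gcongr
        · exact lintegral_deviation_ordConnected_le ha hA
        · exact lintegral_deviation_ordConnected_le ha hB
    _ = 2 * a := by
        rw [← two_mul, ← mul_assoc, ENNReal.inv_mul_cancel (by simp) (by simp), one_mul]

lemma enorm_integral_sub_le_lintegral_levelDeviation (hμ : Integrable g μ)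
    {x : ℝ} (hx : Integrable g (κ x)) :
    ‖∫ y, g y ∂κ x - ∫ y, g y ∂μ‖ₑ ≤ 2 * ∫⁻ t in Ioi 0, levelDeviation κ μ g t x := by
  have hpos : ∀ f : ℝ → ℝ, Integrable f μ → Integrable f (κ x) →
      ‖∫ y, max (f y) 0 ∂κ x - ∫ y, max (f y) 0 ∂μ‖ₑ ≤
        ∫⁻ t in Ioi 0, ‖(κ x).real {y | t < f y} - μ.real {y | t < f y}‖ₑ := fun f hfμ hfκ => by
    refine (enorm_integral_sub_le_lintegral_deviation (f := fun y => max (f y) 0)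
      (fun y => le_max_right _ _) hfκ.pos_part hfμ.pos_part).trans_eq ?_
    refine setLIntegral_congr_fun measurableSet_Ioi fun t (ht : 0 < t) => ?_
    simp [not_lt.2 ht.le]
  have hsplit : ∀ ν : Measure ℝ, Integrable g ν →
      ∫ y, g y ∂ν = ∫ y, max (g y) 0 ∂ν - ∫ y, max (-g y) 0 ∂ν := fun ν hν => by
    rw [← integral_sub hν.pos_part hν.neg_part]
    refine integral_congr_ae (ae_of_all _ fun y => ?_)
    rcases le_total (g y) 0 with h | h <;> simp [h]
  have hm : Measurable fun t : ℝ => ‖(κ x).real {y | t < g y} - μ.real {y | t < g y}‖ₑ := by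
    have h : ∀ ν : Measure ℝ, Measurable fun t : ℝ => ν {y | t < g y} := fun ν =>
      Antitone.measurable fun s t hst => measure_mono fun y (hy : t < g y) => hst.trans_lt hy
    exact ((h _).ennreal_toReal.sub (h _).ennreal_toReal).enorm
  unfold levelDeviation
  rw [lintegral_const_mul' _ _ (by simp), ← mul_assoc, ENNReal.mul_inv_cancel (by simp) (by simp),
    one_mul, lintegral_add_left hm, hsplit _ hμ, hsplit _ hx, sub_sub_sub_comm]
  exact enorm_sub_le.trans (add_le_add (hpos g hμ hx) (hpos (fun y => -g y) hμ.neg hx.neg))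

end LevelDeviation

section MomentBounds

variable {κ : Kernel ℝ ℝ} {μ : Measure ℝ} [IsMarkovKernel κ] [IsProbabilityMeasure μ]
  {M : ℝ} {p : ℝ≥0∞} {f g : ℝ → ℝ} {a : ℝ≥0∞} {q : ℝ}

lemma ae_enorm_integral_sub_rpow_le (hκ : κ ∘ₘ μ = μ) (hg : Measurable g) (hgi : Integrable g μ)
    (hq : 1 ≤ q) :
    ∀ᵐ x ∂μ, ‖∫ y, g y ∂κ x - ∫ y, g y ∂μ‖ₑ ^ q ≤
      2 ^ q * ∫⁻ t, levelDeviation κ μ g t x ∂powMeasure q := by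
  have hint : ∀ᵐ x ∂μ, Integrable g (κ x) :=
    Measure.ae_integrable_of_integrable_comp (by rwa [hκ])
  filter_upwards [hint] with x hx
  calc _ ≤ (2 * ∫⁻ t in Ioi 0, levelDeviation κ μ g t x) ^ q :=
        ENNReal.rpow_le_rpow (enorm_integral_sub_le_lintegral_levelDeviation hgi hx) (by linarith)
    _ ≤ _ := by
        rw [ENNReal.mul_rpow_of_nonneg _ _ (by linarith)]
        exact mul_le_mul_right (rpow_lintegral_le_lintegral_powMeasure
          ((measurable_levelDeviation hg).comp measurable_prodMk_right)
          (fun t => levelDeviation_le_one t x) hq) _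

lemma lintegral_enorm_integral_sub_rpow_le (hκ : κ ∘ₘ μ = μ) (hg : Mon M p μ g)
    (hgi : Integrable g μ) (hq : 1 ≤ q)
    (ha : ∀ t, ∫⁻ x, ‖(κ x).real (Iic t) - μ.real (Iic t)‖ₑ ∂μ ≤ a) :
    ∫⁻ x, ‖∫ y, g y ∂κ x - ∫ y, g y ∂μ‖ₑ ^ q ∂μ ≤
      2 ^ q * ∫⁻ t, min (2 * a) (tailBound M p t) ∂powMeasure q := by
  have hm := measurable_levelDeviation (κ := κ) (μ := μ) hg.measurable
  refine (lintegral_mono_ae (ae_enorm_integral_sub_rpow_le hκ hg.measurable hgi hq)).trans ?_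
  rw [lintegral_const_mul' _ _ (by simp), lintegral_lintegral_swap]
  · gcongr 2 ^ q * ?_
    refine lintegral_mono_ae ((ae_powMeasure_pos q).mono fun t ht => le_min ?_ ?_)
    · exact lintegral_levelDeviation_le_coef hg ha ht.le
    · exact (lintegral_levelDeviation_le_measure hκ hg.measurable ht.le).trans
        (hg.measure_lt_abs_le ht)
  · exact (hm.comp measurable_swap).aemeasurable

lemma lintegral_enorm_rpow_eq {ν : Measure ℝ} (hf : Measurable f) (hq : 0 < q) :
    ∫⁻ x, ‖f x‖ₑ ^ q ∂ν = ∫⁻ s, ν {x | s < |f x|} ∂powMeasure q := by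
  rw [← lintegral_ofReal_rpow ν (fun x => abs_nonneg (f x)) hf.abs hq]
  refine lintegral_congr fun x => ?_
  rw [Real.enorm_eq_ofReal_abs, ENNReal.ofReal_rpow_of_nonneg (abs_nonneg _) hq.le]

lemma enorm_integral_rpow_le (hf : Measurable f) (hq : 1 ≤ q) :
    ‖∫ x, f x ∂μ‖ₑ ^ q ≤ ∫⁻ s, μ {x | s < |f x|} ∂powMeasure q := by
  have hm : Measurable fun s : ℝ => μ {x | s < |f x|} :=
    Antitone.measurable fun s t hst => measure_mono fun x (hx : t < |f x|) => hst.trans_lt hx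
  refine le_trans (ENNReal.rpow_le_rpow (enorm_integral_le_lintegral_enorm f) (by linarith)) ?_
  rw [lintegral_enorm_eq_lintegral_measure_lt_abs hf]
  exact rpow_lintegral_le_lintegral_powMeasure hm (fun _ => prob_le_one) hq

lemma lintegral_enorm_rpow_mul_levelDeviation_le (hκ : κ ∘ₘ μ = μ) (hf : Mon M p μ f)
    (hg : Mon M p μ g) (hq : 1 ≤ q)
    (ha : ∀ t, ∫⁻ x, ‖(κ x).real (Iic t) - μ.real (Iic t)‖ₑ ∂μ ≤ a) :
    ∫⁻ x, ‖f x‖ₑ ^ q * ∫⁻ t, levelDeviation κ μ g t x ∂powMeasure q ∂μ ≤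
      ∫⁻ t, min (2 * a) (tailBound M p t) ∂powMeasure (2 * q) := by
  have hm := measurable_levelDeviation (κ := κ) (μ := μ) hg.measurable
  have hW : Measurable fun x => ∫⁻ t, levelDeviation κ μ g t x ∂powMeasure q :=
    hm.lintegral_prod_left'
  have hfm := hf.measurable
  have hA : ∀ s : ℝ, MeasurableSet {x | s < |f x|} := fun s =>
    measurableSet_lt measurable_const hfm.abs
  have hcoef : ∀ (s t : ℝ), 0 < t →
      ∫⁻ x in {x | s < |f x|}, levelDeviation κ μ g t x ∂μ ≤ 2 * a := fun s t ht =>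
    (setLIntegral_le_lintegral _ _).trans (lintegral_levelDeviation_le_coef hg ha ht.le)
  calc ∫⁻ x, ‖f x‖ₑ ^ q * ∫⁻ t, levelDeviation κ μ g t x ∂powMeasure q ∂μ
      = ∫⁻ x, ‖f x‖ₑ ^ q
          ∂(μ.withDensity fun x => ∫⁻ t, levelDeviation κ μ g t x ∂powMeasure q) := by
        rw [lintegral_withDensity_eq_lintegral_mul _ hW (hfm.enorm.pow_const q)]
        exact lintegral_congr fun x => mul_comm _ _
    _ = ∫⁻ s, ∫⁻ t, ∫⁻ x in {x | s < |f x|}, levelDeviation κ μ g t x ∂μ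
          ∂powMeasure q ∂powMeasure q := by
        rw [lintegral_enorm_rpow_eq hfm (by linarith)]
        refine lintegral_congr fun s => ?_
        rw [withDensity_apply _ (hA s), lintegral_lintegral_swap]
        exact (hm.comp measurable_swap).aemeasurable
    _ ≤ _ := by
        refine lintegral_lintegral_powMeasure_le
          (measurable_const.min (measurable_tailBound M p)) (by linarith)
          (fun s t hs ht => le_min (hcoef s t ht) ?_) (fun s t hs ht => le_min (hcoef s t ht) ?_)
        · calc ∫⁻ x in {x | s < |f x|}, levelDeviation κ μ g t x ∂μ
              ≤ ∫⁻ x in {x | s < |f x|}, 1 ∂μ := lintegral_mono fun x => levelDeviation_le_one t x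
            _ ≤ tailBound M p s := by simpa using hf.measure_lt_abs_le hs
        · exact (setLIntegral_le_lintegral _ _).trans
            ((lintegral_levelDeviation_le_measure hκ hg.measurable ht.le).trans
              (hg.measure_lt_abs_le ht))

lemma enorm_integral_rpow_mul_lintegral_levelDeviation_le (hκ : κ ∘ₘ μ = μ) (hf : Mon M p μ f)
    (hg : Mon M p μ g) (hq : 1 ≤ q)
    (ha : ∀ t, ∫⁻ x, ‖(κ x).real (Iic t) - μ.real (Iic t)‖ₑ ∂μ ≤ a) :
    ∫⁻ x, ‖∫ y, f y ∂μ‖ₑ ^ q * ∫⁻ t, levelDeviation κ μ g t x ∂powMeasure q ∂μ ≤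
      ∫⁻ t, min (2 * a) (tailBound M p t) ∂powMeasure (2 * q) := by
  have hm := measurable_levelDeviation (κ := κ) (μ := μ) hg.measurable
  have hW : Measurable fun x => ∫⁻ t, levelDeviation κ μ g t x ∂powMeasure q :=
    hm.lintegral_prod_left'
  have hP : Measurable fun s : ℝ => μ {x | s < |f x|} :=
    Antitone.measurable fun s t hst => measure_mono fun x (hx : t < |f x|) => hst.trans_lt hx
  have hcoef : ∀ (s t : ℝ), 0 < t →
      μ {x | s < |f x|} * ∫⁻ x, levelDeviation κ μ g t x ∂μ ≤ 2 * a := fun s t ht =>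
    (mul_le_of_le_one_left' prob_le_one).trans (lintegral_levelDeviation_le_coef hg ha ht.le)
  calc ∫⁻ x, ‖∫ y, f y ∂μ‖ₑ ^ q * ∫⁻ t, levelDeviation κ μ g t x ∂powMeasure q ∂μ
      = ‖∫ y, f y ∂μ‖ₑ ^ q * ∫⁻ t, ∫⁻ x, levelDeviation κ μ g t x ∂μ ∂powMeasure q := by
        rw [lintegral_const_mul _ hW, lintegral_lintegral_swap]
        exact (hm.comp measurable_swap).aemeasurable
    _ ≤ (∫⁻ s, μ {x | s < |f x|} ∂powMeasure q) *
          ∫⁻ t, ∫⁻ x, levelDeviation κ μ g t x ∂μ ∂powMeasure q := by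
        gcongr
        exact enorm_integral_rpow_le hf.measurable hq
    _ = ∫⁻ s, ∫⁻ t, μ {x | s < |f x|} * ∫⁻ x, levelDeviation κ μ g t x ∂μ
          ∂powMeasure q ∂powMeasure q := by
        rw [← lintegral_mul_const _ hP]
        exact lintegral_congr fun s => (lintegral_const_mul _ hm.lintegral_prod_right').symm
    _ ≤ _ := by
        refine lintegral_lintegral_powMeasure_le
          (measurable_const.min (measurable_tailBound M p)) (by linarith)
          (fun s t hs ht => le_min (hcoef s t ht) ?_) (fun s t hs ht => le_min (hcoef s t ht) ?_)
        · have h1 : ∫⁻ x, levelDeviation κ μ g t x ∂μ ≤ 1 := by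
            calc _ ≤ ∫⁻ x, 1 ∂μ := lintegral_mono fun x => levelDeviation_le_one t x
              _ = 1 := by simp
          exact (mul_le_of_le_one_right' h1).trans (hf.measure_lt_abs_le hs)
        · exact (mul_le_of_le_one_left' prob_le_one).trans
            ((lintegral_levelDeviation_le_measure hκ hg.measurable ht.le).trans
              (hg.measure_lt_abs_le ht))

lemma lintegral_enorm_mul_integral_sub_rpow_le (hκ : κ ∘ₘ μ = μ) (hf : Mon M p μ f)
    (hg : Mon M p μ g) (hgi : Integrable g μ) (hq : 1 ≤ q)
    (ha : ∀ t, ∫⁻ x, ‖(κ x).real (Iic t) - μ.real (Iic t)‖ₑ ∂μ ≤ a) :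
    ∫⁻ x, ‖(f x - ∫ y, f y ∂μ) * (∫ y, g y ∂κ x - ∫ y, g y ∂μ)‖ₑ ^ q ∂μ ≤
      4 ^ q * ∫⁻ t, min (2 * a) (tailBound M p t) ∂powMeasure (2 * q) := by
  have hq0 : 0 ≤ q := by linarith
  have hm := measurable_levelDeviation (κ := κ) (μ := μ) hg.measurable
  set W : ℝ → ℝ≥0∞ := fun x => ∫⁻ t, levelDeviation κ μ g t x ∂powMeasure q with hW
  have hWm : Measurable W := hm.lintegral_prod_left'
  have hfW : Measurable fun x => ‖f x‖ₑ ^ q * W x :=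
    (hf.measurable.enorm.pow_const q).mul hWm
  set N := ∫⁻ t, min (2 * a) (tailBound M p t) ∂powMeasure (2 * q)
  have h2 : (2 : ℝ≥0∞) ^ (q - 1) * 2 ^ q ≠ ∞ :=
    ENNReal.mul_ne_top (ENNReal.rpow_ne_top_of_nonneg (by linarith) (by simp))
      (ENNReal.rpow_ne_top_of_nonneg hq0 (by simp))
  calc _ ≤ ∫⁻ x, 2 ^ (q - 1) * 2 ^ q * (‖f x‖ₑ ^ q * W x + ‖∫ y, f y ∂μ‖ₑ ^ q * W x) ∂μ := by
        refine lintegral_mono_ae ?_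
        filter_upwards [ae_enorm_integral_sub_rpow_le hκ hg.measurable hgi hq] with x hx
        rw [enorm_mul, ENNReal.mul_rpow_of_nonneg _ _ hq0]
        calc _ ≤ (‖f x‖ₑ + ‖∫ y, f y ∂μ‖ₑ) ^ q * (2 ^ q * W x) :=
              mul_le_mul' (ENNReal.rpow_le_rpow enorm_sub_le hq0) hx
          _ ≤ 2 ^ (q - 1) * (‖f x‖ₑ ^ q + ‖∫ y, f y ∂μ‖ₑ ^ q) * (2 ^ q * W x) := by
              gcongr
              exact ENNReal.rpow_add_le_mul_rpow_add_rpow _ _ hq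
          _ = _ := by ring
    _ ≤ 2 ^ (q - 1) * 2 ^ q * (N + N) := by
        rw [lintegral_const_mul' _ _ h2, lintegral_add_left hfW]
        gcongr
        · exact lintegral_enorm_rpow_mul_levelDeviation_le hκ hf hg hq ha
        · exact enorm_integral_rpow_mul_lintegral_levelDeviation_le hκ hf hg hq ha
    _ = 4 ^ q * N := by
        have h4 : (4 : ℝ≥0∞) ^ q = 2 ^ q * 2 ^ q := by
          rw [← ENNReal.mul_rpow_of_nonneg _ _ hq0]
          norm_num
        have h3 : (2 : ℝ≥0∞) ^ q = 2 ^ (q - 1) * 2 := by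
          conv_lhs => rw [← sub_add_cancel q 1]
          rw [ENNReal.rpow_add _ _ (by simp) (by simp), ENNReal.rpow_one]
        rw [h4]
        nth_rw 2 [h3]
        ring

end MomentBounds

lemma integral_indic (ν : Measure ℝ) (t : ℝ) : ∫ y, indic t y ∂ν = ν.real (Iic t) := by
  simp [indic]

lemma alpha1_nonneg (μ : Measure ℝ) (T : (ℝ → ℝ) → ℝ → ℝ) (n : ℕ) : 0 ≤ alpha1 T μ n :=
  Real.iSup_nonneg fun _ => integral_nonneg fun _ => abs_nonneg _

section Coefficient

variable {K : Kernel ℝ ℝ} {μ : Measure ℝ} [IsProbabilityMeasure μ]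

lemma integrable_indic (t : ℝ) : Integrable (indic t) μ :=
  (integrable_const 1).indicator measurableSet_Iic

lemma lintegral_enorm_real_Iic_sub_le_alpha1 {κ : Kernel ℝ ℝ} [IsMarkovKernel κ] {n : ℕ}
    (h : ∀ g : ℝ → ℝ, Integrable g μ → (Kop K)^[n] g =ᵐ[μ] fun x => ∫ y, g y ∂κ x) (t : ℝ) :
    ∫⁻ x, ‖(κ x).real (Iic t) - μ.real (Iic t)‖ₑ ∂μ ≤ ENNReal.ofReal (alpha1 (Kop K) μ n) := by
  have hle : ∀ t x, |(κ x).real (Iic t) - μ.real (Iic t)| ≤ 1 := fun t x =>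
    abs_sub_le_of_nonneg_of_le measureReal_nonneg measureReal_le_one measureReal_nonneg
      measureReal_le_one
  have hm : ∀ t, Measurable fun x => (κ x).real (Iic t) - μ.real (Iic t) := fun t =>
    (κ.measurable_coe measurableSet_Iic).ennreal_toReal.sub_const _
  have hi : ∀ t, Integrable (fun x => (κ x).real (Iic t) - μ.real (Iic t)) μ := fun t =>
    Integrable.of_bound (hm t).aestronglyMeasurable 1 (ae_of_all _ (hle t))
  have heq : ∀ t, ∫ x, |(Kop K)^[n] (indic t) x - ∫ y, indic t y ∂μ| ∂μ =
      ∫ x, |(κ x).real (Iic t) - μ.real (Iic t)| ∂μ := fun t => by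
    refine integral_congr_ae ?_
    filter_upwards [h _ (integrable_indic t)] with x hx
    rw [hx, integral_indic, integral_indic]
  have hbdd : BddAbove (range fun t => ∫ x, |(Kop K)^[n] (indic t) x - ∫ y, indic t y ∂μ| ∂μ) := by
    refine ⟨1, ?_⟩
    rintro _ ⟨t, rfl⟩
    simp only [heq]
    calc ∫ x, |(κ x).real (Iic t) - μ.real (Iic t)| ∂μ ≤ ∫ x, 1 ∂μ :=
          integral_mono (hi t).abs (integrable_const 1) (hle t)
      _ = 1 := by simp
  rw [← ofReal_integral_norm_eq_lintegral_enorm (hi t)]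
  refine ENNReal.ofReal_le_ofReal ((heq t).symm.le.trans ?_)
  exact le_ciSup hbdd t

end Coefficient

lemma rpow_integral_abs_rpow_le {μ : Measure ℝ} {h : ℝ → ℝ} {q b : ℝ} (hq : 0 < q) (hb : 0 ≤ b)
    (hle : ∫⁻ x, ‖h x‖ₑ ^ q ∂μ ≤ ENNReal.ofReal b) :
    (∫ x, |h x| ^ q ∂μ) ^ (1 / q) ≤ b ^ (1 / q) := by
  refine Real.rpow_le_rpow (integral_nonneg fun x => by positivity) ?_ (by positivity)
  refine (le_abs_self _).trans ?_
  rw [← ENNReal.ofReal_le_ofReal_iff hb, ← Real.enorm_eq_ofReal_abs]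
  refine (enorm_integral_le_lintegral_enorm _).trans ((lintegral_congr fun x => ?_).trans_le hle)
  rw [Real.enorm_eq_ofReal_abs, Real.enorm_eq_ofReal_abs,
    ENNReal.ofReal_rpow_of_nonneg (abs_nonneg _) hq.le, abs_of_nonneg (by positivity)]

lemma toReal_inv_one_sub_ofReal_div {p : ℝ≥0∞} {k : ℝ} (hk : 0 ≤ k) (hp : ENNReal.ofReal k < p) :
    ((1 - ENNReal.ofReal k / p)⁻¹).toReal = (1 - k * p⁻¹.toReal)⁻¹ := by
  have hle : ENNReal.ofReal k / p ≤ 1 := ENNReal.div_le_of_le_mul (by simpa using hp.le)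
  rw [ENNReal.toReal_inv, ENNReal.toReal_sub_of_le hle (by simp), div_eq_mul_inv,
    ENNReal.toReal_mul, ENNReal.toReal_ofReal hk, ENNReal.toReal_one]

lemma mul_toReal_inv_lt_one {p : ℝ≥0∞} {k : ℝ} (hk : 0 ≤ k) (hp : ENNReal.ofReal k < p) :
    k * p⁻¹.toReal < 1 := by
  by_cases hp' : p = ∞
  · simp [hp']
  have h0 : p ≠ 0 := (zero_le.trans_lt hp).ne'
  rw [ENNReal.toReal_inv, ← div_eq_mul_inv, div_lt_one (ENNReal.toReal_pos h0 hp')]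
  rwa [← ENNReal.ofReal_lt_iff_lt_toReal hk hp']

lemma toReal_one_div_sub_div {p : ℝ≥0∞} {q : ℝ} {c : ℝ≥0∞} (hq : 0 < q)
    (hp : c * ENNReal.ofReal q < p) :
    (1 / ENNReal.ofReal q - c / p).toReal = (1 - c.toReal * q * p⁻¹.toReal) * (1 / q) := by
  have hq0 : ENNReal.ofReal q ≠ 0 := by simpa using hq
  have hp0 : p ≠ 0 := (zero_le.trans_lt hp).ne'
  have hle : c / p ≤ 1 / ENNReal.ofReal q := by
    rw [ENNReal.le_div_iff_mul_le (Or.inl hq0) (Or.inl ENNReal.ofReal_ne_top), mul_comm,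
      ← mul_div_assoc, mul_comm]
    exact ENNReal.div_le_of_le_mul (by simpa using hp.le)
  rw [ENNReal.toReal_sub_of_le hle (ENNReal.div_ne_top (by simp) hq0), div_eq_mul_inv c,
    ENNReal.toReal_mul, ENNReal.toReal_div, ENNReal.toReal_ofReal hq.le, ENNReal.toReal_one]
  field_simp

/-- Lemma 3 of Dedecker–Prieur: for `p ∈ (2,∞]` and
`g_i, g_j ∈ Mon(M,p,μ)`:
(a) for `1 ≤ q < p`,
`‖E(g_j(X_n)|X_0) − μ(g_j)‖_q ≤ 2M (p/(p−q))^{1/q} (2α_1(n))^{(p−q)/(pq)}`;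
(b) for `1 ≤ q < p/2`,
`‖(g_i(X_0)−μ(g_i))(E(g_j(X_n)|X_0)−μ(g_j))‖_q
  ≤ 4M² (p/(p−2q))^{1/q} (2α_1(n))^{(p−2q)/(pq)}`.
Here `E(g(X_n)|X_0) = (K^n g)(X_0)` and `X_0 ∼ μ`, so the norms are `L^q(μ)`
norms; for `p = ∞` the exponents are read as the limits `(p−q)/(pq) = 1/q`,
`(p/(p−q))^{1/q} = 1` (this is how the `ℝ≥0∞`-valued formulas below behave). -/
theorem statement3 (μ : Measure ℝ) [IsProbabilityMeasure μ]
    (K : Kernel ℝ ℝ) [IsMarkovKernel K] (hinv : μ.bind (fun x => K x) = μ)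
    (M : ℝ) (hM : 0 < M) (p : ℝ≥0∞) (hp : 2 < p)
    (gi gj : ℝ → ℝ) (hgi : Mon M p μ gi) (hgj : Mon M p μ gj)
    (n : ℕ) (q : ℝ) (hq : 1 ≤ q) :
    (ENNReal.ofReal q < p →
      (∫ x, |(Kop K)^[n] gj x - ∫ y, gj y ∂μ| ^ q ∂μ) ^ (1/q) ≤
        2 * M * (((1 - ENNReal.ofReal q / p)⁻¹).toReal) ^ (1/q) *
          (2 * alpha1 (Kop K) μ n) ^ ((1 / ENNReal.ofReal q - 1 / p).toReal)) ∧
    (ENNReal.ofReal (2 * q) < p →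
      (∫ x, |(gi x - ∫ y, gi y ∂μ) * ((Kop K)^[n] gj x - ∫ y, gj y ∂μ)| ^ q ∂μ) ^ (1/q) ≤
        4 * M ^ 2 * (((1 - ENNReal.ofReal (2 * q) / p)⁻¹).toReal) ^ (1/q) *
          (2 * alpha1 (Kop K) μ n) ^ ((1 / ENNReal.ofReal q - 2 / p).toReal)) := by
  obtain ⟨κ, hκM, hκ, hiter⟩ := exists_kernel_iterate K hinv n
  have hgj_int : Integrable gj μ := hgj.integrable hM (lt_trans (by norm_num) hp)
  have hgκ := hiter gj hgj_int
  have ha := lintegral_enorm_real_Iic_sub_le_alpha1 hiter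
  have hα : 0 ≤ 2 * alpha1 (Kop K) μ n := mul_nonneg zero_le_two (alpha1_nonneg _ _ _)
  have h2α : 2 * ENNReal.ofReal (alpha1 (Kop K) μ n) =
      ENNReal.ofReal (2 * alpha1 (Kop K) μ n) := by
    rw [ENNReal.ofReal_mul zero_le_two, ENNReal.ofReal_ofNat]
  have hp0 : p ≠ 0 := (zero_le.trans_lt hp).ne'
  have hq0 : 0 < q := by linarith
  set α := 2 * alpha1 (Kop K) μ n
  have hroot : ∀ c : ℝ, 0 ≤ c → (c ^ q) ^ (1 / q) = c := fun c hc => by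
    rw [one_div, Real.rpow_rpow_inv hc hq0.ne']
  refine ⟨fun hqp => ?_, fun hqp => ?_⟩
  · have hlt := mul_toReal_inv_lt_one hq0.le hqp
    rw [toReal_inv_one_sub_ofReal_div hq0.le hqp,
      toReal_one_div_sub_div (c := 1) hq0 (by simpa using hqp), ENNReal.toReal_one,
      one_mul]
    have hd : 0 ≤ (1 - q * p⁻¹.toReal)⁻¹ := inv_nonneg.2 (by linarith)
    refine (rpow_integral_abs_rpow_le
      (b := 2 ^ q * (M ^ q * (1 - q * p⁻¹.toReal)⁻¹ * α ^ (1 - q * p⁻¹.toReal))) hq0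
      (by positivity) ?_).trans_eq ?_
    · calc _ = ∫⁻ x, ‖∫ y, gj y ∂κ x - ∫ y, gj y ∂μ‖ₑ ^ q ∂μ :=
            lintegral_congr_ae (hgκ.mono fun x hx => by simp only [hx])
        _ ≤ _ := lintegral_enorm_integral_sub_rpow_le hκ hgj hgj_int hq ha
        _ ≤ _ := by
            rw [h2α, ENNReal.ofReal_mul (p := 2 ^ q) (by positivity),
              ← ENNReal.ofReal_rpow_of_pos zero_lt_two, ENNReal.ofReal_ofNat]
            gcongr
            exact lintegral_min_tailBound_le hM hp0 hα hq0 hlt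
    · rw [Real.mul_rpow (by positivity) (by positivity), Real.mul_rpow (by positivity)
        (by positivity), Real.mul_rpow (by positivity) hd, hroot _ zero_le_two, hroot _ hM.le,
        Real.rpow_mul hα]
      ring
  · have hlt := mul_toReal_inv_lt_one (by positivity) hqp
    have hqp' : 2 * ENNReal.ofReal q < p := by
      rwa [ENNReal.ofReal_mul zero_le_two, ENNReal.ofReal_ofNat] at hqp
    rw [toReal_inv_one_sub_ofReal_div (by positivity) hqp,
      toReal_one_div_sub_div (c := 2) hq0 hqp', ENNReal.toReal_ofNat]
    have hd : 0 ≤ (1 - 2 * q * p⁻¹.toReal)⁻¹ := inv_nonneg.2 (by linarith)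
    refine (rpow_integral_abs_rpow_le
      (b := 4 ^ q * (M ^ (2 * q) * (1 - 2 * q * p⁻¹.toReal)⁻¹ *
        α ^ (1 - 2 * q * p⁻¹.toReal))) hq0 (by positivity) ?_).trans_eq ?_
    · calc _ = ∫⁻ x, ‖(gi x - ∫ y, gi y ∂μ) * (∫ y, gj y ∂κ x - ∫ y, gj y ∂μ)‖ₑ ^ q ∂μ :=
            lintegral_congr_ae (hgκ.mono fun x hx => by simp only [hx])
        _ ≤ _ := lintegral_enorm_mul_integral_sub_rpow_le hκ hgi hgj hgj_int hq ha
        _ ≤ _ := by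
            rw [h2α, ENNReal.ofReal_mul (p := 4 ^ q) (by positivity),
              ← ENNReal.ofReal_rpow_of_pos (by norm_num), ENNReal.ofReal_ofNat]
            gcongr
            exact lintegral_min_tailBound_le hM hp0 hα (by positivity) hlt
    · rw [Real.rpow_mul hM.le, Real.rpow_two, Real.mul_rpow (by positivity) (by positivity),
        Real.mul_rpow (by positivity) (by positivity), Real.mul_rpow (by positivity) hd,
        hroot _ (by norm_num), hroot _ (by positivity), Real.rpow_mul hα]
      ring

end
end

section
/- Let (X_i)_{i≥0} be a stationary ergodic Markov chain with invariant measure μ and transition kernel K. Assume f ∈ C(M,p,μ) for some M > 0 and p ∈ (2,∞], and that Σ_{k>0} (α_1(k))^{(p−2)/p} < ∞. Then the series σ^2(μ,K,f) = μ((f−μ(f))^2) + 2 Σ_{k>0} μ((f−μ(f)) K^k f) converges to a nonnegative real number, and n^{−1} Var(Σ_{i=1}^n f(X_i)) converges to σ^2(μ,K,f) as n → ∞. -/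
open MeasureTheory ProbabilityTheory Filter Set
open scoped ENNReal NNReal Topology

noncomputable section

namespace MarkovCLT

/-- The `n`-fold composition of a kernel with itself. -/
def kpow (K : Kernel ℝ ℝ) : ℕ → Kernel ℝ ℝ
  | 0 => Kernel.id
  | n + 1 => K ∘ₖ kpow K n

instance isMarkovKernel_kpow (K : Kernel ℝ ℝ) [IsMarkovKernel K] (n : ℕ) :
    IsMarkovKernel (kpow K n) := by
  induction n with
  | zero => unfold kpow; infer_instance
  | succ n ih => unfold kpow; infer_instance

lemma kpow_succ' (K : Kernel ℝ ℝ) (n : ℕ) : kpow K (n + 1) = kpow K n ∘ₖ K := by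
  induction n with
  | zero => simp [kpow]
  | succ n ih =>
    change K ∘ₖ kpow K (n + 1) = (K ∘ₖ kpow K n) ∘ₖ K
    rw [ih, Kernel.comp_assoc]

lemma bind_kpow {K : Kernel ℝ ℝ} {μ : Measure ℝ} (hinv : K ∘ₘ μ = μ) (n : ℕ) :
    kpow K n ∘ₘ μ = μ := by
  induction n with
  | zero => simp [kpow]
  | succ n ih => rw [kpow, ← Measure.comp_assoc, ih, hinv]

lemma iterate_Kop_ae_eq {K : Kernel ℝ ℝ} {μ : Measure ℝ} (hinv : K ∘ₘ μ = μ)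
    {f : ℝ → ℝ} (hf : Integrable f μ) (n : ℕ) :
    ∀ᵐ x ∂μ, (Kop K)^[n] f x = ∫ y, f y ∂(kpow K n x) := by
  induction n with
  | zero =>
    have h : kpow K 0 ∘ₘ μ = μ := bind_kpow hinv 0
    rw [← h] at hf
    filter_upwards [Measure.ae_integrable_of_integrable_comp hf] with x hx
    simp only [kpow, Kernel.id_apply] at hx ⊢
    simp
  | succ n ih =>
    rw [← hinv] at ih
    have h1 := bind_kpow hinv (n + 1)
    rw [← h1] at hf
    filter_upwards [Measure.ae_ae_of_ae_comp ih,
      Measure.ae_integrable_of_integrable_comp hf] with x hx hx2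
    rw [Function.iterate_succ_apply', Kop, integral_congr_ae hx]
    rw [kpow_succ'] at hx2 ⊢
    rw [Kernel.integral_comp hx2]

/-- The law of `(X_0, X_n)` for the stationary chain. -/
def joint (μ : Measure ℝ) (K : Kernel ℝ ℝ) (n : ℕ) : Measure (ℝ × ℝ) := μ ⊗ₘ kpow K n

section
variable {μ : Measure ℝ} [IsProbabilityMeasure μ] {K : Kernel ℝ ℝ} [IsMarkovKernel K]

instance isProbabilityMeasure_joint (n : ℕ) : IsProbabilityMeasure (joint μ K n) := by
  unfold joint; infer_instance

lemma measurePreserving_fst_joint (n : ℕ) : MeasurePreserving Prod.fst (joint μ K n) μ :=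
  ⟨measurable_fst, Measure.fst_compProd μ (kpow K n)⟩

lemma measurePreserving_snd_joint (hinv : K ∘ₘ μ = μ) (n : ℕ) :
    MeasurePreserving Prod.snd (joint μ K n) μ :=
  ⟨measurable_snd, (Measure.snd_compProd μ (kpow K n)).trans (bind_kpow hinv n)⟩

lemma integral_mul_iterate_Kop (hinv : K ∘ₘ μ = μ) {a b : ℝ → ℝ} (hb : Integrable b μ) (n : ℕ)
    (hab : Integrable (fun z : ℝ × ℝ => a z.1 * b z.2) (joint μ K n)) :
    ∫ x, a x * (Kop K)^[n] b x ∂μ = ∫ z, a z.1 * b z.2 ∂(joint μ K n) := by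
  rw [joint, Measure.integral_compProd hab]
  refine integral_congr_ae ?_
  filter_upwards [iterate_Kop_ae_eq hinv hb n] with x hx
  rw [hx, integral_const_mul]

lemma map_pair_eq_joint {Ω : Type*} [MeasurableSpace Ω] (P : Measure Ω)
    [IsProbabilityMeasure P] {X : ℕ → Ω → ℝ} (hXm : ∀ i, Measurable (X i))
    (hlaw : ∀ i, P.map (X i) = μ)
    (hMarkov : ∀ n : ℕ, ∀ g : ℝ → ℝ, Measurable g → (∃ C, ∀ x, |g x| ≤ C) →
      P[fun ω => g (X (n + 1) ω)
          | MeasurableSpace.comap (fun ω => fun i : Fin (n + 1) => X i.1 ω) inferInstance]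
        =ᵐ[P] fun ω => Kop K g (X n ω))
    (i k : ℕ) : P.map (fun ω => (X i ω, X (i + k) ω)) = joint μ K k := by
  induction k with
  | zero =>
    refine Measure.ext_prod (fun {s t} hs ht => ?_)
    rw [Measure.map_apply (by fun_prop) (hs.prod ht), joint,
      Measure.compProd_apply_prod hs ht, ← hlaw i]
    simp only [kpow, Kernel.id_apply, add_zero]
    have : ∀ a, Measure.dirac a t = t.indicator 1 a := fun a => Measure.dirac_apply' a ht
    simp_rw [this]
    rw [lintegral_indicator_one ht, Measure.restrict_apply ht,
      Measure.map_apply (hXm i) (ht.inter hs)]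
    congr 1; ext ω; simp [and_comm]
  | succ k ih =>
    have : IsProbabilityMeasure (P.map (fun ω => (X i ω, X (i + (k + 1)) ω))) :=
      Measure.isProbabilityMeasure_map (by fun_prop)
    refine Measure.ext_prod (fun {s t} hs ht => ?_)
    have hm : MeasurableSpace.comap (fun ω => fun j : Fin (i + k + 1) => X j.1 ω) inferInstance
        ≤ (inferInstance : MeasurableSpace Ω) :=
      Measurable.comap_le (by fun_prop)
    have hproj : Measurable fun v : Fin (i + k + 1) → ℝ => v ⟨i, by omega⟩ :=
      measurable_pi_apply _
    have hsm : MeasurableSet[MeasurableSpace.comap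
        (fun ω => fun j : Fin (i + k + 1) => X j.1 ω) inferInstance] (X i ⁻¹' s) :=
      ⟨(fun v : Fin (i + k + 1) → ℝ => v ⟨i, by omega⟩) ⁻¹' s, hproj hs, rfl⟩
    have hint : Integrable (fun ω => t.indicator (1 : ℝ → ℝ) (X (i + k + 1) ω)) P := by
      refine Integrable.of_bound (C := 1) ?_ (ae_of_all _ fun ω => ?_)
      · exact ((measurable_one.indicator ht).comp (hXm _)).aestronglyMeasurable
      · by_cases h : X (i + k + 1) ω ∈ t <;> simp [h]
    have h1 := setIntegral_condExp hm hint hsm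
    have h2 := hMarkov (i + k) (t.indicator 1) (measurable_one.indicator ht)
      ⟨1, fun x => by by_cases h : x ∈ t <;> simp [h]⟩
    rw [setIntegral_congr_ae (hm _ hsm) (h2.mono fun _ h _ => h)] at h1
    have h3 : ∀ x, Kop K (t.indicator 1) x = (K x).real t := fun x => integral_indicator_one ht
    simp_rw [h3] at h1
    have h4 : (fun ω => t.indicator (1 : ℝ → ℝ) (X (i + k + 1) ω))
        = (X (i + k + 1) ⁻¹' t).indicator 1 := rfl
    rw [h4, integral_indicator_one (hXm _ ht), measureReal_restrict_apply (hXm _ ht)] at h1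
    have h5 : ∫ ω in X i ⁻¹' s, (K (X (i + k) ω)).real t ∂P
        = ∫ z in s ×ˢ univ, (K z.2).real t ∂(joint μ K k) := by
      rw [← ih, setIntegral_map (hs.prod .univ) ?_ (by fun_prop)]
      · congr 2; ext ω; simp
      · exact ((K.measurable_coe ht).comp measurable_snd).ennreal_toReal.aestronglyMeasurable
    have h6 : (joint μ K (k + 1)).real (s ×ˢ t)
        = ∫ z in s ×ˢ univ, (K z.2).real t ∂(joint μ K k) := by
      have hme : Measurable fun z : ℝ × ℝ => K z.2 t := (K.measurable_coe ht).comp measurable_snd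
      simp only [Measure.real]
      rw [integral_toReal hme.aemeasurable (ae_of_all _ fun z => measure_lt_top _ _), joint, joint,
        Measure.compProd_apply_prod hs ht, Measure.setLIntegral_compProd hme hs .univ]
      simp [kpow, Kernel.comp_apply' _ _ _ ht]
    rw [Measure.map_apply (by fun_prop) (hs.prod ht), ← measureReal_eq_measureReal_iff, h6, ← h5,
      h1]
    congr 1
    ext ω; simp [and_comm, add_assoc]

end

section
variable {μ : Measure ℝ} {K : Kernel ℝ ℝ}

/-- The covariance `Cov(a(X_0), b(X_n))` along the stationary chain. -/
def lagCov (μ : Measure ℝ) (K : Kernel ℝ ℝ) (n : ℕ) (a b : ℝ → ℝ) : ℝ :=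
  ∫ z, a z.1 * b z.2 ∂(joint μ K n) - ∫ z, a z.1 * b z.2 ∂(μ.prod μ)

/-- The covariance of `a(X_0)` with the indicator of `X_n ∈ J`. -/
def setCov (μ : Measure ℝ) (K : Kernel ℝ ℝ) (n : ℕ) (a : ℝ → ℝ) (J : Set ℝ) : ℝ :=
  ∫ z in Prod.snd ⁻¹' J, a z.1 ∂(joint μ K n) - ∫ z in Prod.snd ⁻¹' J, a z.1 ∂(μ.prod μ)

lemma setCov_eq_lagCov (n : ℕ) (a : ℝ → ℝ) {J : Set ℝ} (hJ : MeasurableSet J) :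
    setCov μ K n a J = lagCov μ K n a (J.indicator fun _ => 1) := by
  have h : ∀ z : ℝ × ℝ, a z.1 * J.indicator (fun _ => 1) z.2
      = (Prod.snd ⁻¹' J).indicator (fun z : ℝ × ℝ => a z.1) z := fun z => by
    by_cases hz : z.2 ∈ J <;> simp [hz]
  simp only [setCov, lagCov, h, integral_indicator (measurable_snd hJ)]

lemma alpha1_nonneg (n : ℕ) : 0 ≤ alpha1 (Kop K) μ n :=
  Real.iSup_nonneg fun _ => integral_nonneg fun _ => abs_nonneg _

variable [IsProbabilityMeasure μ] [IsMarkovKernel K]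

lemma integrable_comp_fst_of_bounded (ρ : Measure (ℝ × ℝ)) [IsFiniteMeasure ρ] {a : ℝ → ℝ} {C : ℝ}
    (ha : Measurable a) (hC : ∀ x, |a x| ≤ C) : Integrable (fun z : ℝ × ℝ => a z.1) ρ :=
  Integrable.of_bound (C := C) (ha.comp measurable_fst).aestronglyMeasurable
    (ae_of_all _ fun z => hC z.1)

lemma setCov_univ (n : ℕ) {a : ℝ → ℝ} (ha : Measurable a) : setCov μ K n a univ = 0 := by
  simp only [setCov, preimage_univ, Measure.restrict_univ]
  have h1 := integral_map (μ := joint μ K n) measurable_fst.aemeasurable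
    (f := a) ha.aestronglyMeasurable
  have h2 := integral_map (μ := μ.prod μ) measurable_fst.aemeasurable
    (f := a) ha.aestronglyMeasurable
  rw [← h1, ← h2, (measurePreserving_fst_joint n).map_eq, measurePreserving_fst.map_eq, sub_self]

lemma setCov_diff (n : ℕ) {a : ℝ → ℝ} {C : ℝ} (ha : Measurable a) (hC : ∀ x, |a x| ≤ C)
    {U V : Set ℝ} (hV : MeasurableSet V) (hVU : V ⊆ U) :
    setCov μ K n a (U \ V) = setCov μ K n a U - setCov μ K n a V := by
  simp only [setCov, preimage_sdiff]
  rw [setIntegral_sdiff₀ (measurable_snd hV).nullMeasurableSet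
      (integrable_comp_fst_of_bounded _ ha hC).integrableOn (preimage_mono hVU),
    setIntegral_sdiff₀ (measurable_snd hV).nullMeasurableSet
      (integrable_comp_fst_of_bounded _ ha hC).integrableOn (preimage_mono hVU)]
  ring

lemma integral_abs_le_alpha1 (hinv : K ∘ₘ μ = μ) (n : ℕ) (t : ℝ) :
    ∫ x, |(Kop K)^[n] (indic t) x - ∫ y, indic t y ∂μ| ∂μ ≤ alpha1 (Kop K) μ n := by
  refine le_ciSup (f := fun t => ∫ x, |(Kop K)^[n] (indic t) x - ∫ y, indic t y ∂μ| ∂μ)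
    ⟨1, ?_⟩ t
  rintro _ ⟨t, rfl⟩
  have hind : Integrable (indic t) μ :=
    (integrable_const (1 : ℝ)).indicator measurableSet_Iic
  have hI : ∀ ν : Measure ℝ, ∫ y, indic t y ∂ν = ν.real (Iic t) := fun ν =>
    integral_indicator_one measurableSet_Iic
  have h0 : ∀ᵐ x ∂μ, ‖|(Kop K)^[n] (indic t) x - ∫ y, indic t y ∂μ|‖ ≤ 1 := ?_
  · exact (le_abs_self _).trans ((norm_integral_le_of_norm_le_const h0).trans (by simp))
  filter_upwards [iterate_Kop_ae_eq hinv hind n] with x hx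
  rw [hx, hI, hI, Real.norm_eq_abs, abs_abs, abs_le]
  have h1 : (kpow K n x).real (Iic t) ≤ 1 := measureReal_le_one
  have h2 : μ.real (Iic t) ≤ 1 := measureReal_le_one
  have h3 : 0 ≤ (kpow K n x).real (Iic t) := measureReal_nonneg
  have h4 : 0 ≤ μ.real (Iic t) := measureReal_nonneg
  constructor <;> linarith

lemma abs_setCov_Iic_le (hinv : K ∘ₘ μ = μ) (n : ℕ) {a : ℝ → ℝ} {C : ℝ} (ha : Measurable a)
    (hC : ∀ x, |a x| ≤ C) (t : ℝ) :
    |setCov μ K n a (Iic t)| ≤ C * alpha1 (Kop K) μ n := by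
  have hC0 : 0 ≤ C := (abs_nonneg _).trans (hC 0)
  have hmind : Measurable (indic t) := measurable_const.indicator measurableSet_Iic
  have hind1 : ∀ y, |indic t y| ≤ 1 := fun y => by
    by_cases h : y ∈ Iic t <;> simp [indic, h]
  have hind : Integrable (indic t) μ := Integrable.of_bound (C := 1) (by fun_prop)
    (ae_of_all _ hind1)
  have hai : Integrable a μ := Integrable.of_bound (C := C) (by fun_prop) (ae_of_all _ hC)
  have hint : Integrable (fun z : ℝ × ℝ => a z.1 * indic t z.2) (joint μ K n) := by
    refine Integrable.of_bound (C := C * 1) (by fun_prop) (ae_of_all _ fun z => ?_)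
    rw [norm_mul]
    exact mul_le_mul (hC _) (hind1 _) (abs_nonneg _) hC0
  have hKm : AEStronglyMeasurable ((Kop K)^[n] (indic t)) μ := by
    refine AEStronglyMeasurable.congr ?_ (EventuallyEq.symm (iterate_Kop_ae_eq hinv hind n))
    exact hmind.stronglyMeasurable.integral_kernel.aestronglyMeasurable
  have hKb : ∀ᵐ x ∂μ, |(Kop K)^[n] (indic t) x| ≤ 1 := by
    filter_upwards [iterate_Kop_ae_eq hinv hind n] with x hx
    rw [hx]
    exact (norm_integral_le_of_norm_le_const (μ := kpow K n x) (f := indic t) (C := 1)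
      (ae_of_all _ hind1)).trans (by simp)
  have hKi : Integrable ((Kop K)^[n] (indic t)) μ := Integrable.of_bound hKm 1 hKb
  rw [setCov_eq_lagCov n a measurableSet_Iic]
  change |lagCov μ K n a (indic t)| ≤ _
  rw [lagCov, ← integral_mul_iterate_Kop hinv hind n hint, integral_prod_mul,
    ← integral_mul_const, ← integral_sub (hKi.bdd_mul (c := C) (by fun_prop) (ae_of_all _ hC))
      (hai.mul_const _)]
  calc |∫ x, (a x * (Kop K)^[n] (indic t) x - a x * ∫ y, indic t y ∂μ) ∂μ|
      ≤ ∫ x, C * |(Kop K)^[n] (indic t) x - ∫ y, indic t y ∂μ| ∂μ := by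
        have hi : Integrable
            (fun x => C * |(Kop K)^[n] (indic t) x - ∫ y, indic t y ∂μ|) μ :=
          ((hKi.sub (integrable_const (∫ y, indic t y ∂μ))).abs).const_mul C
        have hb : ∀ x, ‖a x * (Kop K)^[n] (indic t) x - a x * ∫ y, indic t y ∂μ‖
            ≤ C * |(Kop K)^[n] (indic t) x - ∫ y, indic t y ∂μ| := fun x => by
          rw [← mul_sub, Real.norm_eq_abs, abs_mul]
          exact mul_le_mul_of_nonneg_right (hC x) (abs_nonneg _)
        exact norm_integral_le_of_norm_le hi (ae_of_all _ hb)
    _ ≤ C * alpha1 (Kop K) μ n := by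
        rw [integral_const_mul]
        exact mul_le_mul_of_nonneg_left (integral_abs_le_alpha1 hinv n t) hC0

lemma abs_setCov_le_of_isLowerSet (hinv : K ∘ₘ μ = μ) (n : ℕ) {a : ℝ → ℝ} {C : ℝ}
    (ha : Measurable a) (hC : ∀ x, |a x| ≤ C) {L : Set ℝ} (hL : IsLowerSet L) :
    |setCov μ K n a L| ≤ C * alpha1 (Kop K) μ n := by
  have hpos : 0 ≤ C * alpha1 (Kop K) μ n :=
    mul_nonneg ((abs_nonneg _).trans (hC 0)) (alpha1_nonneg n)
  rcases L.eq_empty_or_nonempty with rfl | hne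
  · simpa [setCov] using hpos
  by_cases hb : BddAbove L
  · by_cases hs : sSup L ∈ L
    · have : L = Iic (sSup L) := by
        ext x
        exact ⟨fun hx => le_csSup hb hx, fun hx => hL hx hs⟩
      rw [this]
      exact abs_setCov_Iic_le hinv n ha hC _
    · have hLI : L = ⋃ m : ℕ, Iic (sSup L - 1 / ((m : ℝ) + 1)) := by
        ext x
        simp only [mem_iUnion, mem_Iic]
        constructor
        · intro hx
          have hlt : x < sSup L := lt_of_le_of_ne (le_csSup hb hx) fun h => hs (h ▸ hx)
          obtain ⟨m, hm⟩ := exists_nat_one_div_lt (sub_pos.2 hlt)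
          exact ⟨m, by linarith⟩
        · rintro ⟨m, hm⟩
          have : (0 : ℝ) < 1 / ((m : ℝ) + 1) := by positivity
          obtain ⟨y, hy, hxy⟩ := exists_lt_of_lt_csSup hne (show x < sSup L by linarith)
          exact hL hxy.le hy
      have hmono : Monotone fun m : ℕ => Iic (sSup L - 1 / ((m : ℝ) + 1)) := by
        intro i j hij
        refine Iic_subset_Iic.2 (sub_le_sub_left ?_ _)
        exact Nat.one_div_le_one_div hij
      have hT : ∀ ρ : Measure (ℝ × ℝ), IsFiniteMeasure ρ → Tendsto (fun m : ℕ =>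
          ∫ z in Prod.snd ⁻¹' Iic (sSup L - 1 / ((m : ℝ) + 1)), a z.1 ∂ρ) atTop
          (𝓝 (∫ z in Prod.snd ⁻¹' L, a z.1 ∂ρ)) := by
        intro ρ hρ
        have hu : Prod.snd ⁻¹' L = ⋃ m : ℕ,
            (Prod.snd ⁻¹' Iic (sSup L - 1 / ((m : ℝ) + 1)) : Set (ℝ × ℝ)) := by
          rw [← preimage_iUnion, ← hLI]
        rw [hu]
        exact tendsto_setIntegral_of_monotone (fun m => measurable_snd measurableSet_Iic)
          (fun i j hij => preimage_mono (hmono hij))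
          (integrable_comp_fst_of_bounded ρ ha hC).integrableOn
      have hlim := ((hT (joint μ K n) inferInstance).sub (hT (μ.prod μ) inferInstance)).abs
      exact le_of_tendsto hlim (Eventually.of_forall fun m => abs_setCov_Iic_le hinv n ha hC _)
  · have : L = univ := by
      refine eq_univ_of_forall fun x => ?_
      obtain ⟨y, hy, hxy⟩ := not_bddAbove_iff.1 hb x
      exact hL hxy.le hy
    rw [this, setCov_univ n ha, abs_zero]
    exact hpos

lemma abs_setCov_le_of_ordConnected (hinv : K ∘ₘ μ = μ) (n : ℕ) {a : ℝ → ℝ} {C : ℝ}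
    (ha : Measurable a) (hC : ∀ x, |a x| ≤ C) {J : Set ℝ} (hJ : J.OrdConnected) :
    |setCov μ K n a J| ≤ 2 * (C * alpha1 (Kop K) μ n) := by
  have hpos : 0 ≤ C * alpha1 (Kop K) μ n :=
    mul_nonneg ((abs_nonneg _).trans (hC 0)) (alpha1_nonneg n)
  rcases J.eq_empty_or_nonempty with rfl | ⟨w, hw⟩
  · simpa [setCov] using hpos
  let U : Set ℝ := {x | ∃ y ∈ J, x ≤ y}
  let V : Set ℝ := {x | ∀ y ∈ J, x < y}
  have hU : IsLowerSet U := fun x y hyx ⟨z, hz, hxz⟩ => ⟨z, hz, hyx.trans hxz⟩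
  have hV : IsLowerSet V := fun x y hyx h z hz => hyx.trans_lt (h z hz)
  have hVU : V ⊆ U := fun x hx => ⟨w, hw, (hx w hw).le⟩
  have hJUV : J = U \ V := by
    ext x
    constructor
    · exact fun hx => ⟨⟨x, hx, le_rfl⟩, fun h => lt_irrefl _ (h x hx)⟩
    · rintro ⟨⟨y, hy, hxy⟩, hxV⟩
      simp only [V, mem_ofPred_eq, not_forall, not_lt] at hxV
      obtain ⟨z, hz, hzx⟩ := hxV
      exact hJ.out hz hy ⟨hzx, hxy⟩
  have h1 := abs_setCov_le_of_isLowerSet hinv n ha hC hU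
  have h2 := abs_setCov_le_of_isLowerSet hinv n ha hC hV
  rw [hJUV, setCov_diff n ha hC hV.ordConnected.measurableSet hVU]
  refine (abs_sub _ _).trans ?_
  linarith

/-- Every strict superlevel set of `h` is an interval or the complement of an interval. -/
def IntervalLevels (h : ℝ → ℝ) : Prop :=
  ∀ s : ℝ, {x | s < h x}.OrdConnected ∨ {x | s < h x}ᶜ.OrdConnected

lemma IntervalLevels.measurable {h : ℝ → ℝ} (hh : IntervalLevels h) : Measurable h :=
  measurable_of_Ioi fun s => by
    rcases hh s with h1 | h1
    · exact h1.measurableSet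
    · exact h1.measurableSet.of_compl

/-- Truncation at level `T`. -/
def trunc (T x : ℝ) : ℝ := max (-T) (min x T)

@[fun_prop]
lemma measurable_trunc (T : ℝ) : Measurable (trunc T) := by
  unfold trunc; fun_prop

lemma abs_trunc_le {T : ℝ} (hT : 0 ≤ T) (x : ℝ) : |trunc T x| ≤ T :=
  abs_le.2 ⟨le_max_left _ _, max_le (by linarith) (min_le_right _ _)⟩

lemma IntervalLevels.trunc {h : ℝ → ℝ} (hh : IntervalLevels h) (T : ℝ) :
    IntervalLevels fun x => trunc T (h x) := by
  intro s
  by_cases h1 : s < -T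
  · left
    have : {x | s < MarkovCLT.trunc T (h x)} = univ :=
      eq_univ_of_forall fun x => lt_max_of_lt_left h1
    rw [this]; exact ordConnected_univ
  by_cases h2 : T ≤ s
  · left
    have : {x | s < MarkovCLT.trunc T (h x)} = ∅ := by
      refine eq_empty_of_forall_notMem fun x hx => ?_
      rw [mem_ofPred_eq, MarkovCLT.trunc] at hx
      rcases lt_max_iff.1 hx with h3 | h3
      · exact h1 h3
      · exact absurd (h3.trans_le (min_le_right _ _)) (not_lt.2 h2)
    rw [this]; exact ordConnected_empty
  · have : {x | s < MarkovCLT.trunc T (h x)} = {x | s < h x} := by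
      ext x
      simp [MarkovCLT.trunc, h1, not_le.1 h2]
    rw [this]; exact hh s

lemma abs_setCov_superlevel_le (hinv : K ∘ₘ μ = μ) (n : ℕ) {a : ℝ → ℝ} {C : ℝ}
    (ha : Measurable a) (hC : ∀ x, |a x| ≤ C) {h : ℝ → ℝ} (hh : IntervalLevels h) (s : ℝ) :
    |setCov μ K n a {x | s < h x}| ≤ 2 * (C * alpha1 (Kop K) μ n) := by
  rcases hh s with h1 | h1
  · exact abs_setCov_le_of_ordConnected hinv n ha hC h1
  · have h2 := setCov_diff (μ := μ) (K := K) n ha hC h1.measurableSet (subset_univ _)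
    rw [setCov_univ n ha, ← compl_eq_univ_sdiff, compl_compl] at h2
    rw [h2, zero_sub, abs_neg]
    exact abs_setCov_le_of_ordConnected hinv n ha hC h1

lemma intervalIntegral_indicator_Iio {T u : ℝ} (hu : |u| ≤ T) :
    ∫ s in (-T)..T, (Iio u).indicator (fun _ => (1 : ℝ)) s = u + T := by
  have h := abs_le.1 hu
  have hset : Iio u ∩ Ioc (-T) T = Ioo (-T) u := by
    ext s
    simp only [mem_inter_iff, mem_Iio, mem_Ioc, mem_Ioo]
    constructor
    · rintro ⟨h1, h2, -⟩; exact ⟨h2, h1⟩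
    · rintro ⟨h1, h2⟩; exact ⟨h2, h1, by linarith⟩
  rw [intervalIntegral.integral_of_le (by linarith)]
  have := integral_indicator_one (μ := volume.restrict (Ioc (-T) T)) (measurableSet_Iio (a := u))
  refine this.trans ?_
  rw [measureReal_restrict_apply measurableSet_Iio, hset, Real.volume_real_Ioo_of_le h.1]
  ring

lemma integral_mul_eq_intervalIntegral (ρ : Measure (ℝ × ℝ)) [IsProbabilityMeasure ρ]
    {a h : ℝ → ℝ} {C T : ℝ} (ha : Measurable a) (hC : ∀ x, |a x| ≤ C) (hh : Measurable h)
    (hT : ∀ x, |h x| ≤ T) :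
    IntervalIntegrable (fun s => ∫ z in Prod.snd ⁻¹' {x | s < h x}, a z.1 ∂ρ) volume (-T) T ∧
    ∫ z, a z.1 * h z.2 ∂ρ + T * ∫ z, a z.1 ∂ρ
      = ∫ s in (-T)..T, ∫ z in Prod.snd ⁻¹' {x | s < h x}, a z.1 ∂ρ := by
  have hC0 : 0 ≤ C := (abs_nonneg _).trans (hC 0)
  have hT0 : 0 ≤ T := (abs_nonneg _).trans (hT 0)
  let F : ℝ → ℝ × ℝ → ℝ := fun s z => a z.1 * (Iio (h z.2)).indicator (fun _ => (1 : ℝ)) s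
  have hF : ∀ s, ∫ z in Prod.snd ⁻¹' {x | s < h x}, a z.1 ∂ρ = ∫ z, F s z ∂ρ := fun s => by
    rw [← integral_indicator (measurable_snd (measurableSet_lt measurable_const hh))]
    congr 1; ext z
    by_cases hz : s < h z.2 <;> simp [F, hz]
  have hFm : Measurable (Function.uncurry F) := by
    have : Function.uncurry F = fun q : ℝ × ℝ × ℝ =>
        a q.2.1 * {q : ℝ × ℝ × ℝ | q.1 < h q.2.2}.indicator (fun _ => (1 : ℝ)) q := by
      ext q
      by_cases hz : q.1 < h q.2.2 <;> simp [F, hz, Function.uncurry]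
    rw [this]
    refine Measurable.mul (by fun_prop) (measurable_const.indicator ?_)
    exact measurableSet_lt (by fun_prop) (by fun_prop)
  have hFi : Integrable (Function.uncurry F) ((volume.restrict (uIoc (-T) T)).prod ρ) := by
    have : IsFiniteMeasure (volume.restrict (uIoc (-T) T)) := by
      constructor
      rw [Measure.restrict_apply_univ, uIoc]
      exact measure_Ioc_lt_top
    refine Integrable.of_bound (C := C * 1) hFm.aestronglyMeasurable (ae_of_all _ fun q => ?_)
    simp only [Function.uncurry, F, norm_mul]
    refine mul_le_mul (hC _) ?_ (norm_nonneg _) hC0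
    by_cases hz : q.1 < h q.2.2 <;> simp [hz]
  simp_rw [hF]
  constructor
  · rw [intervalIntegrable_iff]
    exact hFi.integral_prod_left
  · rw [intervalIntegral_integral_swap hFi]
    have : ∀ z, ∫ s in (-T)..T, F s z = a z.1 * h z.2 + T * a z.1 := fun z => by
      simp only [F, intervalIntegral.integral_const_mul, intervalIntegral_indicator_Iio (hT z.2)]
      ring
    simp_rw [this]
    rw [integral_add, integral_const_mul]
    · refine Integrable.of_bound (C := C * T) (by fun_prop) (ae_of_all _ fun z => ?_)
      rw [norm_mul]
      exact mul_le_mul (hC _) (hT _) (norm_nonneg _) hC0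
    · exact (integrable_comp_fst_of_bounded ρ ha hC).const_mul T

lemma abs_lagCov_le_of_bounded (hinv : K ∘ₘ μ = μ) (n : ℕ) {a h : ℝ → ℝ} {C T : ℝ}
    (ha : Measurable a) (hC : ∀ x, |a x| ≤ C) (hh : IntervalLevels h) (hT : ∀ x, |h x| ≤ T) :
    |lagCov μ K n a h| ≤ 4 * C * T * alpha1 (Kop K) μ n := by
  have hT0 : 0 ≤ T := (abs_nonneg _).trans (hT 0)
  obtain ⟨i1, e1⟩ := integral_mul_eq_intervalIntegral (joint μ K n) ha hC hh.measurable hT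
  obtain ⟨i2, e2⟩ := integral_mul_eq_intervalIntegral (μ.prod μ) ha hC hh.measurable hT
  have h0 := setCov_univ (μ := μ) (K := K) n ha
  simp only [setCov, preimage_univ, Measure.restrict_univ] at h0
  have key : lagCov μ K n a h = ∫ s in (-T)..T, setCov μ K n a {x | s < h x} := by
    simp only [setCov]
    rw [intervalIntegral.integral_sub i1 i2, ← e1, ← e2, lagCov]
    linear_combination (-T) * h0
  rw [key]
  refine (intervalIntegral.norm_integral_le_of_norm_le_const
    (f := fun s => setCov μ K n a {x | s < h x}) (C := 2 * (C * alpha1 (Kop K) μ n)) fun s _ =>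
      abs_setCov_superlevel_le hinv n ha hC hh s).trans_eq ?_
  rw [abs_of_nonneg (by linarith)]
  ring

end

section

lemma trunc_cases {T : ℝ} (hT : 0 ≤ T) (a : ℝ) :
    (-T ≤ a ∧ a ≤ T ∧ trunc T a = a) ∨ (T < a ∧ trunc T a = T) ∨ (a < -T ∧ trunc T a = -T) := by
  unfold trunc
  rcases lt_or_ge T a with h | h
  · exact Or.inr (Or.inl ⟨h, by rw [min_eq_right h.le, max_eq_right (by linarith)]⟩)
  rcases lt_or_ge a (-T) with h' | h'
  · exact Or.inr (Or.inr ⟨h', by rw [min_eq_left h, max_eq_left h'.le]⟩)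
  · exact Or.inl ⟨h', h, by rw [min_eq_left h, max_eq_right h']⟩

lemma abs_mul_sub_trunc_mul_trunc_le {T : ℝ} (hT : 0 ≤ T) (a b : ℝ) :
    |a * b - trunc T a * trunc T b| ≤ (max (a ^ 2 - T ^ 2) 0 + max (b ^ 2 - T ^ 2) 0) / 2 := by
  have hA := le_max_left (a ^ 2 - T ^ 2) 0
  have hA0 := le_max_right (a ^ 2 - T ^ 2) 0
  have hB := le_max_left (b ^ 2 - T ^ 2) 0
  have hB0 := le_max_right (b ^ 2 - T ^ 2) 0
  generalize max (a ^ 2 - T ^ 2) 0 = A at *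
  generalize max (b ^ 2 - T ^ 2) 0 = B at *
  rcases trunc_cases hT a with ⟨h1, h2, h⟩ | ⟨h1, h⟩ | ⟨h1, h⟩ <;>
  rcases trunc_cases hT b with ⟨h3, h4, h'⟩ | ⟨h3, h'⟩ | ⟨h3, h'⟩ <;>
  rw [h, h', abs_le] <;> constructor <;>
  nlinarith [sq_nonneg (a - b), sq_nonneg (a + b), sq_nonneg (a - T), sq_nonneg (b - T),
    sq_nonneg (a + T), sq_nonneg (b + T)]

variable {μ : Measure ℝ} [IsProbabilityMeasure μ]

lemma MemLp.integrable_max_sq_sub {g : ℝ → ℝ} (hg : MemLp g 2 μ) (T : ℝ) :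
    Integrable (fun x => max (g x ^ 2 - T ^ 2) 0) μ :=
  (hg.integrable_sq.sub (integrable_const _)).pos_part

omit [IsProbabilityMeasure μ] in
lemma integrable_mul_of_marginals {ρ : Measure (ℝ × ℝ)} (h1 : MeasurePreserving Prod.fst ρ μ)
    (h2 : MeasurePreserving Prod.snd ρ μ) {g h : ℝ → ℝ} (hg : MemLp g 2 μ) (hh : MemLp h 2 μ) :
    Integrable (fun z : ℝ × ℝ => g z.1 * h z.2) ρ :=
  (hg.comp_measurePreserving h1).integrable_mul (hh.comp_measurePreserving h2)

lemma abs_integral_mul_sub_trunc_le {ρ : Measure (ℝ × ℝ)} [IsProbabilityMeasure ρ]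
    (h1 : MeasurePreserving Prod.fst ρ μ)
    (h2 : MeasurePreserving Prod.snd ρ μ) {g h : ℝ → ℝ} {T δ : ℝ} (hT : 0 ≤ T)
    (hg2 : MemLp g 2 μ) (hh2 : MemLp h 2 μ)
    (hgδ : ∫ x, max (g x ^ 2 - T ^ 2) 0 ∂μ ≤ δ) (hhδ : ∫ x, max (h x ^ 2 - T ^ 2) 0 ∂μ ≤ δ) :
    |∫ z, g z.1 * h z.2 ∂ρ - ∫ z, trunc T (g z.1) * trunc T (h z.2) ∂ρ| ≤ δ := by
  have ht : ∀ {u : ℝ → ℝ}, MemLp u 2 μ → MemLp (fun x => trunc T (u x)) 2 μ := fun {u} hu =>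
    MemLp.of_bound ((measurable_trunc T).comp_aemeasurable hu.1.aemeasurable).aestronglyMeasurable
      T (ae_of_all _ fun x => abs_trunc_le hT _)
  have ig := h1.integrable_comp_of_integrable (MemLp.integrable_max_sq_sub hg2 T)
  have ih := h2.integrable_comp_of_integrable (MemLp.integrable_max_sq_sub hh2 T)
  rw [← integral_sub (integrable_mul_of_marginals h1 h2 hg2 hh2)
    (integrable_mul_of_marginals h1 h2 (ht hg2) (ht hh2))]
  have hb : ∀ z : ℝ × ℝ, ‖g z.1 * h z.2 - trunc T (g z.1) * trunc T (h z.2)‖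
      ≤ (max (g z.1 ^ 2 - T ^ 2) 0 + max (h z.2 ^ 2 - T ^ 2) 0) / 2 :=
    fun z => abs_mul_sub_trunc_mul_trunc_le hT _ _
  refine (norm_integral_le_of_norm_le ((ig.add ih).div_const 2) (ae_of_all _ hb)).trans ?_
  rw [integral_div, integral_add' ig ih]
  have e1 := integral_map (μ := ρ) h1.measurable.aemeasurable
    (f := fun x => max (g x ^ 2 - T ^ 2) 0)
    (by rw [h1.map_eq]; exact (MemLp.integrable_max_sq_sub hg2 T).1)
  have e2 := integral_map (μ := ρ) h2.measurable.aemeasurable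
    (f := fun x => max (h x ^ 2 - T ^ 2) 0)
    (by rw [h2.map_eq]; exact (MemLp.integrable_max_sq_sub hh2 T).1)
  rw [h1.map_eq] at e1
  rw [h2.map_eq] at e2
  simp only [Function.comp_def]
  linarith

variable {K : Kernel ℝ ℝ} [IsMarkovKernel K]

lemma abs_lagCov_le_of_tail (hinv : K ∘ₘ μ = μ) (n : ℕ) {g h : ℝ → ℝ} {T δ : ℝ} (hT : 0 ≤ T)
    (hg : IntervalLevels g) (hh : IntervalLevels h) (hg2 : MemLp g 2 μ) (hh2 : MemLp h 2 μ)
    (hgδ : ∫ x, max (g x ^ 2 - T ^ 2) 0 ∂μ ≤ δ) (hhδ : ∫ x, max (h x ^ 2 - T ^ 2) 0 ∂μ ≤ δ) :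
    |lagCov μ K n g h| ≤ 4 * T ^ 2 * alpha1 (Kop K) μ n + 2 * δ := by
  have b1 := abs_integral_mul_sub_trunc_le (measurePreserving_fst_joint (K := K) n)
    (measurePreserving_snd_joint hinv n) hT hg2 hh2 hgδ hhδ
  have b2 := abs_integral_mul_sub_trunc_le (measurePreserving_fst (μ := μ) (ν := μ))
    measurePreserving_snd hT hg2 hh2 hgδ hhδ
  have b3 := abs_lagCov_le_of_bounded hinv n (hg.trunc T).measurable
    (fun x => abs_trunc_le hT (g x)) (hh.trunc T) (fun x => abs_trunc_le hT (h x))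
  simp only [lagCov] at b3 ⊢
  rw [abs_le] at *
  constructor <;> nlinarith

omit [IsProbabilityMeasure μ] in
lemma Mon.intervalLevels {M : ℝ} {p : ℝ≥0∞} {g : ℝ → ℝ} (hg : Mon M p μ g) :
    IntervalLevels g := by
  obtain ⟨⟨I, -, hI, hmon, h0⟩, -⟩ := hg
  intro s
  rcases le_or_gt 0 s with hs | hs
  · left
    refine ⟨fun x hx y hy z hz => ?_⟩
    rw [mem_ofPred_eq] at hx hy ⊢
    have hxI : x ∈ I := by_contra fun h => by rw [h0 x h] at hx; linarith
    have hyI : y ∈ I := by_contra fun h => by rw [h0 y h] at hy; linarith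
    have hzI : z ∈ I := hI.out hxI hyI hz
    rcases hmon with hm | hm
    · exact hx.trans_le (hm hxI hzI hz.1)
    · exact hy.trans_le (hm hzI hyI hz.2)
  · right
    refine ⟨fun x hx y hy z hz => ?_⟩
    rw [mem_compl_iff, mem_ofPred_eq, not_lt] at hx hy ⊢
    have hxI : x ∈ I := by_contra fun h => by rw [h0 x h] at hx; linarith
    have hyI : y ∈ I := by_contra fun h => by rw [h0 y h] at hy; linarith
    have hzI : z ∈ I := hI.out hxI hyI hz
    rcases hmon with hm | hm
    · exact (hm hzI hyI hz.2).trans hy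
    · exact (hm hxI hzI hz.1).trans hx

end

section
variable {μ : Measure ℝ}

lemma lintegral_add_rpow_Ioi {c r : ℝ} (hc : 0 < c) (hr : r < -1) :
    ∫⁻ t in Ioi (0 : ℝ), ENNReal.ofReal ((t + c) ^ r)
      = ENNReal.ofReal (-c ^ (r + 1) / (r + 1)) := by
  have h1 : IntegrableOn (fun t : ℝ => (t + c) ^ r) (Ioi 0) :=
    integrableOn_add_rpow_Ioi_of_lt hr (by linarith)
  rw [← ofReal_integral_eq_lintegral_ofReal h1
    ((ae_restrict_iff' measurableSet_Ioi).2 (ae_of_all _ fun t ht =>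
      Real.rpow_nonneg (by have : 0 < t := ht; positivity) _))]
  congr 1
  rw [← integral_Ioi_rpow_of_lt hr hc]
  have := (measurePreserving_add_right (volume : Measure ℝ) c).setIntegral_preimage_emb
    (measurableEmbedding_addRight c) (fun t => t ^ r) (Ioi c)
  rw [← this]
  simp

/-- A second-moment bound for the part of `g` above level `T`, from a weak `L^q` bound. -/
lemma lintegral_max_sq_sub_le {g : ℝ → ℝ} (hg : Measurable g) {M q T : ℝ} (hM : 0 ≤ M)
    (hq : 2 < q) (hT : 0 < T)
    (h : ∀ t : ℝ, 0 < t → μ {x | t < |g x|} ≤ ENNReal.ofReal (M ^ q * t ^ (-q))) :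
    ∫⁻ x, ENNReal.ofReal (max (g x ^ 2 - T ^ 2) 0) ∂μ
      ≤ ENNReal.ofReal (M ^ q / (q / 2 - 1) * T ^ (2 - q)) := by
  rw [lintegral_eq_lintegral_meas_lt μ (f := fun x => max (g x ^ 2 - T ^ 2) 0)
    (ae_of_all _ fun x => le_max_right _ _) (by fun_prop)]
  have hle : ∀ t ∈ Ioi (0 : ℝ), μ {x | t < max (g x ^ 2 - T ^ 2) 0}
      ≤ ENNReal.ofReal (M ^ q) * ENNReal.ofReal ((t + T ^ 2) ^ (-(q / 2))) := by
    intro t ht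
    have ht : 0 < t := ht
    have hs : 0 < t + T ^ 2 := by positivity
    have := h (√(t + T ^ 2)) (Real.sqrt_pos.2 hs)
    rw [Real.sqrt_eq_rpow, ← Real.rpow_mul hs.le, ENNReal.ofReal_mul (by positivity)] at this
    rw [show -(q / 2) = 1 / 2 * -q by ring]
    refine (measure_mono fun x hx => ?_).trans this
    rw [mem_ofPred_eq] at hx ⊢
    rw [← Real.sqrt_eq_rpow, ← Real.sqrt_sq_eq_abs]
    refine Real.sqrt_lt_sqrt hs.le ?_
    rcases lt_max_iff.1 hx with h | h <;> linarith
  refine (setLIntegral_mono' measurableSet_Ioi hle).trans ?_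
  rw [lintegral_const_mul _ (by fun_prop),
    lintegral_add_rpow_Ioi (by positivity) (by linarith), ← ENNReal.ofReal_mul (by positivity)]
  refine ENNReal.ofReal_le_ofReal (le_of_eq ?_)
  rw [← Real.rpow_natCast, ← Real.rpow_mul hT.le]
  rw [show ((2 : ℕ) : ℝ) * (-(q / 2) + 1) = 2 - q by push_cast; ring]
  rw [show -(q / 2) + 1 = -(q / 2 - 1) by ring, neg_div_neg_eq]
  ring

/-- Membership in `L²` together with a bound on the second moment above each level. -/
def SqTail (μ : Measure ℝ) (δ : ℝ → ℝ) (g : ℝ → ℝ) : Prop :=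
  MemLp g 2 μ ∧ ∀ T, 0 < T → ∫ x, max (g x ^ 2 - T ^ 2) 0 ∂μ ≤ δ T

variable [IsProbabilityMeasure μ]

lemma Mon.exists_sqTail {M : ℝ} (hM : 0 < M) {p : ℝ≥0∞} (hp : 2 < p) :
    ∃ (δ : ℝ → ℝ) (C : ℝ), 0 ≤ C ∧ Tendsto δ atTop (𝓝 0) ∧
      (∀ g, Mon M p μ g → SqTail μ δ g) ∧
      ∀ α, 0 ≤ α → ∀ D, (∀ T, 0 < T → D ≤ 4 * T ^ 2 * α + 2 * δ T) →
        D ≤ C * α ^ ((1 : ℝ≥0∞) - 2 / p).toReal := by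
  by_cases hpt : p = ∞
  · subst hpt
    refine ⟨fun T => if M ≤ T then 0 else M ^ 2, 4 * M ^ 2, by positivity, ?_, ?_, ?_⟩
    · refine tendsto_const_nhds.congr' ?_
      filter_upwards [eventually_ge_atTop M] with T hT
      simp [hT]
    · intro g hg
      have hgm := (Mon.intervalLevels hg).measurable
      have hb : ∀ᵐ x ∂μ, |g x| ≤ M := by
        have := hg.2
        rw [if_pos rfl] at this
        rw [ae_iff]
        simpa using this
      refine ⟨MemLp.of_bound hgm.aestronglyMeasurable M (by simpa using hb), fun T hT => ?_⟩
      have hb' : ∀ᵐ x ∂μ, max (g x ^ 2 - T ^ 2) 0 ≤ if M ≤ T then 0 else M ^ 2 := by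
        filter_upwards [hb] with x hx
        have h2 : g x ^ 2 ≤ M ^ 2 := sq_le_sq' (abs_le.1 hx).1 (abs_le.1 hx).2
        split_ifs with h
        · exact max_le (by nlinarith) le_rfl
        · exact max_le (by nlinarith [sq_nonneg T]) (by positivity)
      have := integral_mono_of_nonneg (ae_of_all _ fun x => le_max_right _ _)
        (integrable_const _) hb'
      simpa using this
    · intro α _ D hD
      have := hD M hM
      simp at this ⊢
      linarith
  · set q := p.toReal with hq
    have hq2 : 2 < q := by
      have := (ENNReal.toReal_lt_toReal (by simp) hpt).2 hp
      simpa using this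
    have hr : ((1 : ℝ≥0∞) - 2 / p).toReal = 1 - 2 / q := by
      rw [ENNReal.toReal_sub_of_le ?_ (by simp), ENNReal.toReal_div]
      · simp [hq]
      · exact ENNReal.div_le_of_le_mul (by simpa using hp.le)
    have hA : 0 ≤ M ^ q / (q / 2 - 1) := div_nonneg (by positivity) (by linarith)
    set A := M ^ q / (q / 2 - 1) with hAdef
    have hlim : Tendsto (fun T : ℝ => A * T ^ (2 - q)) atTop (𝓝 0) := by
      have := (tendsto_rpow_neg_atTop (y := q - 2) (by linarith)).const_mul A
      simpa using this
    refine ⟨fun T => A * T ^ (2 - q), 4 + 2 * A, by positivity, hlim, ?_, ?_⟩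
    · intro g hg
      have hgm := (Mon.intervalLevels hg).measurable
      have htail := hg.2
      rw [if_neg hpt] at htail
      have key := fun (T : ℝ) (hT : 0 < T) =>
        lintegral_max_sq_sub_le hgm hM.le hq2 hT htail
      have hint : ∀ T, 0 < T → Integrable (fun x => max (g x ^ 2 - T ^ 2) 0) μ := by
        intro T hT
        refine ⟨by fun_prop, ?_⟩
        rw [hasFiniteIntegral_iff_ofReal (f := fun x => max (g x ^ 2 - T ^ 2) 0)
          (ae_of_all _ fun x => le_max_right _ _)]
        exact (key T hT).trans_lt ENNReal.ofReal_lt_top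
      refine ⟨?_, fun T hT => ?_⟩
      · rw [memLp_two_iff_integrable_sq hgm.aestronglyMeasurable]
        refine ((hint 1 one_pos).add (integrable_const 1)).mono' (by fun_prop)
          (ae_of_all _ fun x => ?_)
        rw [Real.norm_of_nonneg (sq_nonneg _), Pi.add_apply]
        linarith [le_max_left (g x ^ 2 - 1 ^ 2) 0]
      · rw [integral_eq_lintegral_of_nonneg_ae (f := fun x => max (g x ^ 2 - T ^ 2) 0)
          (ae_of_all _ fun x => le_max_right _ _) (by fun_prop)]
        exact ENNReal.toReal_le_of_le_ofReal (by positivity) (key T hT)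
    · intro α hα D hD
      rw [hr]
      have hexp : 0 < 1 - 2 / q := by
        rw [sub_pos, div_lt_one (by linarith)]; exact hq2
      rcases hα.eq_or_lt with rfl | hα
      · rw [Real.zero_rpow hexp.ne', mul_zero]
        have h2 : Tendsto (fun T : ℝ => 4 * T ^ 2 * 0 + 2 * (A * T ^ (2 - q))) atTop (𝓝 0) := by
          simpa using hlim.const_mul 2
        refine ge_of_tendsto h2 ?_
        filter_upwards [eventually_gt_atTop 0] with T hT using hD T hT
      · have := hD (α ^ (-(1 / q))) (by positivity)
        refine this.trans (le_of_eq ?_)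
        have e1 : (α ^ (-(1 / q))) ^ 2 * α = α ^ (1 - 2 / q) := by
          rw [← Real.rpow_natCast, ← Real.rpow_mul hα.le]
          nth_rw 2 [← Real.rpow_one α]
          rw [← Real.rpow_add hα]
          congr 1; push_cast; ring
        have e2 : (α ^ (-(1 / q))) ^ (2 - q) = α ^ (1 - 2 / q) := by
          rw [← Real.rpow_mul hα.le]
          congr 1
          field_simp
          ring
        beta_reduce
        rw [e2, ← e1]
        ring
end

section
variable {μ : Measure ℝ} [IsProbabilityMeasure μ]

lemma SqTail.eLpNorm_indicator_le {δ : ℝ → ℝ} {g : ℝ → ℝ} (hg : SqTail μ δ g) {s : Set ℝ}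
    (hs : MeasurableSet s) {T : ℝ} (hT : 0 < T) :
    eLpNorm (s.indicator g) 2 μ ≤ ENNReal.ofReal (√(δ T + T ^ 2 * μ.real s)) := by
  rw [(hg.1.indicator hs).eLpNorm_eq_integral_rpow_norm (by simp) (by simp)]
  refine ENNReal.ofReal_le_ofReal ?_
  rw [Real.sqrt_eq_rpow]
  have he : ((2 : ℝ≥0∞).toReal)⁻¹ = (1 / 2 : ℝ) := by norm_num
  rw [he]
  refine Real.rpow_le_rpow (integral_nonneg fun x => by positivity) ?_ (by norm_num)
  have hi : Integrable (s.indicator fun _ => T ^ 2) μ := (integrable_const (T ^ 2)).indicator hs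
  have hm := MemLp.integrable_max_sq_sub hg.1 T
  calc ∫ x, ‖s.indicator g x‖ ^ (2 : ℝ≥0∞).toReal ∂μ
      ≤ ∫ x, max (g x ^ 2 - T ^ 2) 0 + s.indicator (fun _ => T ^ 2) x ∂μ := by
        refine integral_mono_of_nonneg (ae_of_all _ fun x => by positivity) (hm.add hi)
          (ae_of_all _ fun x => ?_)
        by_cases hx : x ∈ s
        · simp only [hx, indicator_of_mem, ENNReal.toReal_ofNat, Real.rpow_ofNat, Real.norm_eq_abs,
            sq_abs]
          linarith [le_max_left (g x ^ 2 - T ^ 2) 0]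
        · simp [hx]
    _ = ∫ x, max (g x ^ 2 - T ^ 2) 0 ∂μ + μ.real s * T ^ 2 := by
        rw [integral_add hm hi, integral_indicator_const _ hs, smul_eq_mul]
    _ ≤ _ := by linarith [hg.2 T hT]

/-- Combinations `∑ a_i g_i` with `∑ |a_i| ≤ 1` of functions satisfying `q`. -/
def AbsConvexComb (q : (ℝ → ℝ) → Prop) (φ : ℝ → ℝ) : Prop :=
  ∃ (n : ℕ) (a : Fin n → ℝ) (g : Fin n → ℝ → ℝ), ∑ i, |a i| ≤ 1 ∧ (∀ i, q (g i)) ∧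
    φ = ∑ i, a i • g i

omit [IsProbabilityMeasure μ] in
lemma AbsConvexComb.memLp {q : (ℝ → ℝ) → Prop} (hq : ∀ g, q g → MemLp g 2 μ) {φ : ℝ → ℝ}
    (hφ : AbsConvexComb q φ) : MemLp φ 2 μ := by
  obtain ⟨n, a, g, -, hg, rfl⟩ := hφ
  exact memLp_finsetSum' _ fun i _ => (hq _ (hg i)).const_smul (a i)

omit [IsProbabilityMeasure μ] in
lemma AbsConvexComb.eLpNorm_indicator_le {q : (ℝ → ℝ) → Prop} (hq : ∀ g, q g → MemLp g 2 μ)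
    {s : Set ℝ} (hs : MeasurableSet s) {B : ℝ}
    (hB : ∀ g, q g → eLpNorm (s.indicator g) 2 μ ≤ ENNReal.ofReal B) {φ : ℝ → ℝ}
    (hφ : AbsConvexComb q φ) : eLpNorm (s.indicator φ) 2 μ ≤ ENNReal.ofReal B := by
  obtain ⟨n, a, g, ha, hg, rfl⟩ := hφ
  have e : s.indicator (∑ i, a i • g i) = ∑ i, a i • s.indicator (g i) := by
    ext x
    by_cases hx : x ∈ s <;> simp [hx]
  rw [e]
  calc eLpNorm (∑ i, a i • s.indicator (g i)) 2 μ
      ≤ ∑ i, eLpNorm (a i • s.indicator (g i)) 2 μ :=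
        eLpNorm_sum_le (fun i _ => (((hq _ (hg i)).indicator hs).const_smul (a i)).1) (by norm_num)
    _ ≤ ∑ i, ENNReal.ofReal |a i| * ENNReal.ofReal B := by
        refine Finset.sum_le_sum fun i _ => ?_
        rw [eLpNorm_const_smul, ← Real.norm_eq_abs, ofReal_norm]
        gcongr
        exact hB _ (hg i)
    _ = ENNReal.ofReal (∑ i, |a i|) * ENNReal.ofReal B := by
        rw [← Finset.sum_mul, ENNReal.ofReal_sum_of_nonneg fun i _ => abs_nonneg _]
    _ ≤ 1 * ENNReal.ofReal B := by
        gcongr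
        simpa using ENNReal.ofReal_le_ofReal ha
    _ = _ := one_mul _

lemma uniformIntegrable_of_absConvexComb {δ : ℝ → ℝ} (hδ : Tendsto δ atTop (𝓝 0))
    {φ : ℕ → ℝ → ℝ} (hφ : ∀ m, AbsConvexComb (SqTail μ δ) (φ m)) :
    UniformIntegrable φ 2 μ := by
  have hq : ∀ g, SqTail μ δ g → MemLp g 2 μ := fun g hg => hg.1
  refine ⟨fun m => ((hφ m).memLp hq).1, fun ε hε => ?_, (√(δ 1 + 1)).toNNReal, fun m => ?_⟩
  · have h1 : ∀ᶠ T in atTop, δ T < ε ^ 2 / 2 := hδ.eventually_lt_const (by positivity)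
    obtain ⟨T, hT, hT0⟩ := (h1.and (eventually_gt_atTop 0)).exists
    refine ⟨ε ^ 2 / (2 * T ^ 2), by positivity, fun m s hs hμs => ?_⟩
    refine (hφ m).eLpNorm_indicator_le hq hs fun g hg => ?_
    refine (hg.eLpNorm_indicator_le hs hT0).trans (ENNReal.ofReal_le_ofReal ?_)
    rw [Real.sqrt_le_left hε.le]
    have h2 : μ.real s ≤ ε ^ 2 / (2 * T ^ 2) := ENNReal.toReal_le_of_le_ofReal (by positivity) hμs
    have h3 : T ^ 2 * μ.real s ≤ ε ^ 2 / 2 := by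
      calc T ^ 2 * μ.real s ≤ T ^ 2 * (ε ^ 2 / (2 * T ^ 2)) := by gcongr
        _ = ε ^ 2 / 2 := by field_simp
    linarith
  · have := (hφ m).eLpNorm_indicator_le hq MeasurableSet.univ (B := √(δ 1 + 1)) fun g hg => by
      simpa using hg.eLpNorm_indicator_le MeasurableSet.univ one_pos
    simpa [ENNReal.ofReal] using this

omit [IsProbabilityMeasure μ] in
lemma tendsto_integral_mul_of_tendsto_eLpNorm {ρ : Measure (ℝ × ℝ)}
    (h1 : MeasurePreserving Prod.fst ρ μ) (h2 : MeasurePreserving Prod.snd ρ μ)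
    {φ : ℕ → ℝ → ℝ} {f : ℝ → ℝ} (hφ : ∀ m, MemLp (φ m) 2 μ) (hf : MemLp f 2 μ)
    (h : Tendsto (fun m => eLpNorm (φ m - f) 2 μ) atTop (𝓝 0)) :
    Tendsto (fun m => ∫ z, φ m z.1 * φ m z.2 ∂ρ) atTop (𝓝 (∫ z, f z.1 * f z.2 ∂ρ)) := by
  have key : ∀ {π : ℝ × ℝ → ℝ} (hπ : MeasurePreserving π ρ μ),
      Tendsto (fun m => ((hφ m).comp_measurePreserving hπ).toLp (φ m ∘ π)) atTop
        (𝓝 ((hf.comp_measurePreserving hπ).toLp (f ∘ π))) := by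
    intro π hπ
    rw [Lp.tendsto_Lp_iff_tendsto_eLpNorm'']
    refine h.congr fun m => ?_
    exact (eLpNorm_comp_measurePreserving ((hφ m).sub hf).1 hπ).symm
  have hin : ∀ {u : ℝ → ℝ} (hu : MemLp u 2 μ),
      inner ℝ ((hu.comp_measurePreserving h1).toLp (u ∘ Prod.fst))
        ((hu.comp_measurePreserving h2).toLp (u ∘ Prod.snd)) = ∫ z, u z.1 * u z.2 ∂ρ := by
    intro u hu
    rw [L2.inner_def]
    refine integral_congr_ae ?_
    filter_upwards [(hu.comp_measurePreserving h1).coeFn_toLp,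
      (hu.comp_measurePreserving h2).coeFn_toLp] with z e1 e2
    rw [e1, e2]
    simp [mul_comm]
  rw [← hin hf]
  exact (Filter.Tendsto.inner (𝕜 := ℝ) (key h1) (key h2)).congr fun m => hin (hφ m)

variable {K : Kernel ℝ ℝ} [IsMarkovKernel K]

lemma AbsConvexComb.abs_lagCov_le (hinv : K ∘ₘ μ = μ) (n : ℕ) {q : (ℝ → ℝ) → Prop}
    (hq : ∀ g, q g → MemLp g 2 μ) {B : ℝ} (hB0 : 0 ≤ B)
    (hB : ∀ g h, q g → q h → |lagCov μ K n g h| ≤ B) {φ : ℝ → ℝ} (hφ : AbsConvexComb q φ) :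
    |lagCov μ K n φ φ| ≤ B := by
  obtain ⟨m, a, g, ha, hg, rfl⟩ := hφ
  have key : ∀ {ρ : Measure (ℝ × ℝ)}, MeasurePreserving Prod.fst ρ μ →
      MeasurePreserving Prod.snd ρ μ →
      ∫ z, (∑ i, a i • g i) z.1 * (∑ i, a i • g i) z.2 ∂ρ
        = ∑ i, ∑ j, a i * a j * ∫ z, g i z.1 * g j z.2 ∂ρ := by
    intro ρ h1 h2
    have hi : ∀ i j, Integrable (fun z : ℝ × ℝ => a i * a j * (g i z.1 * g j z.2)) ρ :=
      fun i j => (integrable_mul_of_marginals h1 h2 (hq _ (hg i)) (hq _ (hg j))).const_mul _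
    have e : ∀ z : ℝ × ℝ, (∑ i, a i • g i) z.1 * (∑ i, a i • g i) z.2
        = ∑ i, ∑ j, a i * a j * (g i z.1 * g j z.2) := fun z => by
      simp only [Finset.sum_apply, Pi.smul_apply, smul_eq_mul, Finset.sum_mul_sum]
      exact Finset.sum_congr rfl fun i _ => Finset.sum_congr rfl fun j _ => by ring
    simp_rw [e]
    rw [integral_finsetSum _ fun i _ => integrable_finsetSum _ fun j _ => hi i j]
    refine Finset.sum_congr rfl fun i _ => ?_
    rw [integral_finsetSum _ fun j _ => hi i j]
    exact Finset.sum_congr rfl fun j _ => integral_const_mul _ _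
  have e : lagCov μ K n (∑ i, a i • g i) (∑ i, a i • g i)
      = ∑ i, ∑ j, a i * a j * lagCov μ K n (g i) (g j) := by
    simp only [lagCov]
    rw [key (measurePreserving_fst_joint n) (measurePreserving_snd_joint hinv n),
      key measurePreserving_fst measurePreserving_snd]
    simp only [← Finset.sum_sub_distrib, mul_sub]
  rw [e]
  calc |∑ i, ∑ j, a i * a j * lagCov μ K n (g i) (g j)|
      ≤ ∑ i, ∑ j, |a i| * |a j| * B := by
        refine (Finset.abs_sum_le_sum_abs _ _).trans (Finset.sum_le_sum fun i _ => ?_)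
        refine (Finset.abs_sum_le_sum_abs _ _).trans (Finset.sum_le_sum fun j _ => ?_)
        rw [abs_mul, abs_mul]
        gcongr
        exact hB _ _ (hg i) (hg j)
    _ = (∑ i, |a i|) * (∑ i, |a i|) * B := by
        rw [Finset.sum_mul_sum, Finset.sum_mul]
        exact Finset.sum_congr rfl fun i _ => (Finset.sum_mul _ _ _).symm
    _ ≤ 1 * B := by
        have h0 : 0 ≤ ∑ i, |a i| := Finset.sum_nonneg fun i _ => abs_nonneg _
        gcongr
        nlinarith
    _ = B := one_mul B

/-- The covariance inequality for `ClassC` functions. -/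
lemma ClassC.memLp_and_abs_lagCov_le (hinv : K ∘ₘ μ = μ) {M : ℝ} (hM : 0 < M) {p : ℝ≥0∞}
    (hp : 2 < p) {f : ℝ → ℝ} (hf : ClassC M p μ f) :
    MemLp f 2 μ ∧ ∃ C, ∀ n, |lagCov μ K n f f|
      ≤ C * alpha1 (Kop K) μ n ^ ((1 : ℝ≥0∞) - 2 / p).toReal := by
  obtain ⟨δ, C, hC, hδ, hMon, hopt⟩ := Mon.exists_sqTail (μ := μ) hM hp
  have happ : ∀ m : ℕ, ∃ φ, AbsConvexComb (Mon M p μ) φ ∧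
      ∫ x, |f x - φ x| ∂μ < 1 / ((m : ℝ) + 1) := fun m => by
    obtain ⟨n, a, g, ha, hg, h⟩ := hf.2 (1 / ((m : ℝ) + 1)) (by positivity)
    exact ⟨_, ⟨n, a, g, ha, hg, rfl⟩, by simpa using h⟩
  choose φ hφ hφf using happ
  have hq : ∀ g, Mon M p μ g → MemLp g 2 μ := fun g hg => (hMon g hg).1
  have hφ2 : ∀ m, MemLp (φ m) 2 μ := fun m => (hφ m).memLp hq
  have hui : UniformIntegrable φ 2 μ := uniformIntegrable_of_absConvexComb hδ fun m => by
    obtain ⟨n, a, g, ha, hg, h⟩ := hφ m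
    exact ⟨n, a, g, ha, fun i => hMon _ (hg i), h⟩
  have hmeas : TendstoInMeasure μ φ atTop f := by
    refine tendstoInMeasure_of_tendsto_eLpNorm one_ne_zero (fun m => (hφ2 m).1) hf.1.1 ?_
    have e : ∀ m, eLpNorm (φ m - f) 1 μ = ENNReal.ofReal (∫ x, |f x - φ m x| ∂μ) := fun m => by
      rw [eLpNorm_sub_comm, eLpNorm_one_eq_lintegral_enorm,
        ← ofReal_integral_norm_eq_lintegral_enorm
          (hf.1.sub ((hφ2 m).integrable (by norm_num)))]
      rfl
    simp_rw [e]
    rw [← ENNReal.ofReal_zero]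
    refine ENNReal.tendsto_ofReal ?_
    exact squeeze_zero (fun m => integral_nonneg fun x => abs_nonneg _) (fun m => (hφf m).le)
      tendsto_one_div_add_atTop_nhds_zero_nat
  have hf2 : MemLp f 2 μ := hui.memLp_of_tendstoInMeasure hmeas
  have hlim := tendsto_Lp_finite_of_tendstoInMeasure (by norm_num) (by simp)
    (fun m => (hφ2 m).1) hf2 hui.2.1 hmeas
  refine ⟨hf2, C, fun n => ?_⟩
  have h1 : Tendsto (fun m => lagCov μ K n (φ m) (φ m)) atTop (𝓝 (lagCov μ K n f f)) :=
    (tendsto_integral_mul_of_tendsto_eLpNorm (measurePreserving_fst_joint n)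
      (measurePreserving_snd_joint hinv n) hφ2 hf2 hlim).sub
    (tendsto_integral_mul_of_tendsto_eLpNorm measurePreserving_fst measurePreserving_snd
      hφ2 hf2 hlim)
  refine le_of_tendsto' h1.abs fun m => ?_
  have hα : 0 ≤ alpha1 (Kop K) μ n := alpha1_nonneg n
  refine (hφ m).abs_lagCov_le hinv n hq (mul_nonneg hC (Real.rpow_nonneg hα _))
    fun g h hg hh => hopt _ hα _ fun T hT => ?_
  exact abs_lagCov_le_of_tail hinv n hT.le (Mon.intervalLevels hg) (Mon.intervalLevels hh)
    (hq g hg) (hq h hh) ((hMon g hg).2 T hT) ((hMon h hh).2 T hT)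

end

section

lemma sum_range_sum_range_eq_of_symm {c : ℕ → ℕ → ℝ} {γ : ℕ → ℝ} (hsymm : ∀ i j, c i j = c j i)
    (hc : ∀ i k, c i (i + k) = γ k) (n : ℕ) :
    ∑ i ∈ Finset.range n, ∑ j ∈ Finset.range n, c i j
      = ∑ m ∈ Finset.range n, (γ 0 + 2 * ∑ k ∈ Finset.range m, γ (k + 1)) := by
  induction n with
  | zero => simp
  | succ n ih =>
    have h1 : ∑ i ∈ Finset.range n, c i n = ∑ k ∈ Finset.range n, γ (k + 1) := by
      rw [← Finset.sum_range_reflect]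
      refine Finset.sum_congr rfl fun k hk => ?_
      have hk := Finset.mem_range.1 hk
      rw [← hc (n - 1 - k) (k + 1)]
      congr 1
      omega
    have h2 : ∑ j ∈ Finset.range n, c n j = ∑ k ∈ Finset.range n, γ (k + 1) := by
      simp_rw [hsymm n, h1]
    have h3 : c n n = γ 0 := hc n 0
    simp only [Finset.sum_range_succ, Finset.sum_add_distrib] at ih ⊢
    rw [h1, h2, h3]
    linarith

variable {μ : Measure ℝ} [IsProbabilityMeasure μ] {K : Kernel ℝ ℝ} [IsMarkovKernel K]

lemma lagCov_eq_covariance (hinv : K ∘ₘ μ = μ) (k : ℕ) {f : ℝ → ℝ} (hf : MemLp f 2 μ) :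
    lagCov μ K k f f
      = covariance (fun z : ℝ × ℝ => f z.1) (fun z : ℝ × ℝ => f z.2) (joint μ K k) := by
  have h1 := measurePreserving_fst_joint (μ := μ) (K := K) k
  have h2 := measurePreserving_snd_joint hinv k
  have m1 : MemLp (fun z : ℝ × ℝ => f z.1) 2 (joint μ K k) := hf.comp_measurePreserving h1
  have m2 : MemLp (fun z : ℝ × ℝ => f z.2) 2 (joint μ K k) := hf.comp_measurePreserving h2
  have e1 := integral_map (μ := joint μ K k) h1.measurable.aemeasurable (f := f)
    (by rw [h1.map_eq]; exact hf.1)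
  have e2 := integral_map (μ := joint μ K k) h2.measurable.aemeasurable (f := f)
    (by rw [h2.map_eq]; exact hf.1)
  rw [h1.map_eq] at e1
  rw [h2.map_eq] at e2
  rw [covariance_eq_sub m1 m2, ← e1, ← e2, lagCov, integral_prod_mul]
  rfl

lemma integral_sub_mul_iterate_Kop (hinv : K ∘ₘ μ = μ) (k : ℕ) {f : ℝ → ℝ} (hf : MemLp f 2 μ) :
    ∫ x, (f x - ∫ y, f y ∂μ) * (Kop K)^[k] f x ∂μ = lagCov μ K k f f := by
  have h1 := measurePreserving_fst_joint (μ := μ) (K := K) k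
  have h2 := measurePreserving_snd_joint hinv k
  have hf1 : Integrable f μ := hf.integrable (by norm_num)
  have hc : MemLp (fun x => f x - ∫ y, f y ∂μ) 2 μ := hf.sub (memLp_const _)
  have hi := integrable_mul_of_marginals h1 h2 hf hf
  have hs : Integrable (fun z : ℝ × ℝ => f z.2) (joint μ K k) :=
    h2.integrable_comp_of_integrable hf1
  rw [integral_mul_iterate_Kop hinv hf1 k (integrable_mul_of_marginals h1 h2 hc hf)]
  simp_rw [sub_mul]
  have e2 := integral_map (μ := joint μ K k) h2.measurable.aemeasurable (f := f)
    (by rw [h2.map_eq]; exact hf.1)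
  rw [h2.map_eq] at e2
  rw [integral_sub hi (hs.const_mul _), integral_const_mul, ← e2, lagCov, integral_prod_mul]

end

end MarkovCLT

/-- Theorem 3(1) of Dedecker–Prieur: for a stationary ergodic
Markov chain `(X_i)` with invariant measure `μ` and kernel `K`, if
`f ∈ C(M,p,μ)` with `p ∈ (2,∞]` and `Σ_{k>0} α_1(k)^{(p−2)/p} < ∞`, then the
series `σ²(μ,K,f) = μ((f−μ(f))²) + 2Σ_{k>0} μ((f−μ(f))K^k f)` converges to a
nonnegative number and `n⁻¹ Var(Σ_{i=1}^n f(X_i)) → σ²(μ,K,f)`. -/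
theorem statement5 {Ω : Type*} [MeasurableSpace Ω] (P : Measure Ω)
    [IsProbabilityMeasure P] (X : ℕ → Ω → ℝ) (hXm : ∀ i, Measurable (X i))
    (μ : Measure ℝ) [IsProbabilityMeasure μ]
    (K : Kernel ℝ ℝ) [IsMarkovKernel K] (hinv : μ.bind (fun x => K x) = μ)
    (hX0 : Measure.map (X 0) P = μ)
    (hMarkov : ∀ n : ℕ, ∀ g : ℝ → ℝ, Measurable g → (∃ C, ∀ x, |g x| ≤ C) →
      P[fun ω => g (X (n + 1) ω)
          | MeasurableSpace.comap (fun ω => fun i : Fin (n + 1) => X i.1 ω) inferInstance]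
        =ᵐ[P] fun ω => Kop K g (X n ω))
    (hstat : ∀ k n : ℕ,
      Measure.map (fun ω => fun i : Fin n => X (i.1 + k) ω) P
        = Measure.map (fun ω => fun i : Fin n => X i.1 ω) P)
    (hErg : Ergodic (fun x : ℕ → ℝ => fun i => x (i + 1))
      (Measure.map (fun ω => fun i => X i ω) P))
    (M : ℝ) (hM : 0 < M) (p : ℝ≥0∞) (hp : 2 < p)
    (f : ℝ → ℝ) (hf : ClassC M p μ f)
    (hsum : Summable fun k : ℕ =>
      (alpha1 (Kop K) μ (k + 1)) ^ (((1:ℝ≥0∞) - 2 / p).toReal)) :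
    ∃ S : ℝ,
      HasSum (fun k : ℕ =>
        ∫ x, (f x - ∫ y, f y ∂μ) * (Kop K)^[k + 1] f x ∂μ) S ∧
      0 ≤ (∫ x, (f x - ∫ y, f y ∂μ) ^ 2 ∂μ) + 2 * S ∧
      Tendsto (fun n : ℕ => (n : ℝ)⁻¹ *
          variance (fun ω => ∑ i ∈ Finset.range n, f (X (i + 1) ω)) P)
        atTop (𝓝 ((∫ x, (f x - ∫ y, f y ∂μ) ^ 2 ∂μ) + 2 * S)) := by
  have hinv' : K ∘ₘ μ = μ := hinv
  obtain ⟨hf2, C, hC⟩ := MarkovCLT.ClassC.memLp_and_abs_lagCov_le hinv' hM hp hf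
  have hlaw : ∀ i, P.map (X i) = μ := fun i => by
    have h := congrArg (Measure.map fun v : Fin 1 → ℝ => v 0) (hstat i 1)
    rw [Measure.map_map (by fun_prop) (by fun_prop),
      Measure.map_map (by fun_prop) (by fun_prop)] at h
    rw [← hX0]
    simpa [Function.comp_def] using h
  have hpair := MarkovCLT.map_pair_eq_joint P hXm hlaw hMarkov
  set γ : ℕ → ℝ := fun k => MarkovCLT.lagCov μ K k f f with hγ
  have hcov : ∀ i k, covariance (fun ω => f (X i ω)) (fun ω => f (X (i + k) ω)) P = γ k := by
    intro i k
    have hm1 := hf2.1.comp_measurePreserving (MarkovCLT.measurePreserving_fst_joint (K := K) k)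
    have hm2 := hf2.1.comp_measurePreserving (MarkovCLT.measurePreserving_snd_joint hinv' k)
    rw [← hpair i k] at hm1 hm2
    rw [hγ]
    beta_reduce
    rw [MarkovCLT.lagCov_eq_covariance hinv' k hf2, ← hpair i k]
    exact (covariance_map hm1 hm2 (by fun_prop)).symm
  have hvar0 : ∫ x, (f x - ∫ y, f y ∂μ) ^ 2 ∂μ = γ 0 := by
    have hm : AEStronglyMeasurable f (P.map (X 0)) := by rw [hX0]; exact hf2.1
    have h := covariance_map hm hm (hXm 0).aemeasurable
    rw [hX0, covariance_self hf2.1.aemeasurable, variance_eq_integral hf2.1.aemeasurable] at h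
    rw [h]
    exact hcov 0 0
  have hvar : ∀ n : ℕ, variance (fun ω => ∑ i ∈ Finset.range n, f (X (i + 1) ω)) P
      = ∑ m ∈ Finset.range n, (γ 0 + 2 * ∑ k ∈ Finset.range m, γ (k + 1)) := fun n => by
    rw [variance_fun_sum' (X := fun i ω => f (X (i + 1) ω))
      fun i _ => hf2.comp_measurePreserving ⟨hXm (i + 1), hlaw (i + 1)⟩]
    refine MarkovCLT.sum_range_sum_range_eq_of_symm (fun i j => covariance_comm _ _)
      (fun i k => ?_) n
    rw [← hcov (i + 1) k, add_right_comm]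
  have hS : Summable fun k => γ (k + 1) :=
    Summable.of_norm_bounded (hsum.mul_left C) fun k => hC (k + 1)
  have hlim : Tendsto (fun n : ℕ => (n : ℝ)⁻¹ *
      variance (fun ω => ∑ i ∈ Finset.range n, f (X (i + 1) ω)) P)
      atTop (𝓝 (γ 0 + 2 * ∑' k, γ (k + 1))) := by
    simp_rw [hvar]
    exact ((hS.hasSum.tendsto_sum_nat.const_mul 2).const_add (γ 0)).cesaro
  rw [hvar0]
  refine ⟨∑' k, γ (k + 1), ?_, ge_of_tendsto' hlim fun n => ?_, hlim⟩
  · simpa only [MarkovCLT.integral_sub_mul_iterate_Kop hinv' _ hf2] using hS.hasSum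
  · exact mul_nonneg (by positivity) (variance_nonneg _ _)

end
end
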